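/- arXiv:1903.01833 — 4 statements merged into one kernel-verified Lean document; each statement's English description precedes it below -/
import Mathlib

section
/- Let Ω ⊆ ℝⁿ be a bounded connected open set and suppose φ ∈ C²(closure Ω) satisfies φ > 0 in Ω, φ = 0 on ∂Ω and −Δφ = λ₁φ in Ω for some λ₁ > 0 (a principal Dirichlet eigenfunction). If λ > 0 and u ∈ C²(closure Ω) solves Δu + λe^u = 0 in Ω with u = 0 on ∂Ω, then λ ≤ λ₁. -/
open Real MeasureTheory Metric Set Filter

noncomputable section

/-- The Euclidean Laplacian of `f : ℝⁿ → ℝ` at `x`. -/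
def lap {n : ℕ} (f : EuclideanSpace ℝ (Fin n) → ℝ) (x : EuclideanSpace ℝ (Fin n)) : ℝ :=
  ∑ i : Fin n, iteratedFDeriv ℝ 2 f x ![EuclideanSpace.single i 1, EuclideanSpace.single i 1]

/-- At a local minimum of a function on the line, the second derivative is nonnegative. -/
theorem IsLocalMin.deriv_deriv_nonneg {g : ℝ → ℝ} {a : ℝ} (hmin : IsLocalMin g a)
    (hg : ContinuousAt g a) : 0 ≤ deriv (deriv g) a := by
  by_contra! hneg
  have hmax : IsLocalMax g a := isLocalMax_of_deriv_deriv_neg hneg hmin.deriv_eq_zero hg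
  have hconst : g =ᶠ[nhds a] fun _ => g a := by
    filter_upwards [hmin, hmax] with y hy hy' using le_antisymm hy' hy
  simp [hconst.deriv.deriv_eq] at hneg

/-- At a local minimum of a `C²` function, the second derivative is a nonnegative form. -/
theorem IsLocalMin.iteratedFDeriv_two_nonneg {E : Type*} [NormedAddCommGroup E]
    [NormedSpace ℝ E] {f : E → ℝ} {x : E} (hmin : IsLocalMin f x) (hf : ContDiffAt ℝ 2 f x)
    (v : E) : 0 ≤ iteratedFDeriv ℝ 2 f x ![v, v] := by
  have hline (s : ℝ) : HasDerivAt (fun s : ℝ => x + s • v) v s := by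
    simpa using ((hasDerivAt_id s).smul_const v).const_add x
  have hline0 : Tendsto (fun s : ℝ => x + s • v) (nhds 0) (nhds x) := by
    simpa using (hline 0).continuousAt.tendsto
  have hderiv : deriv (fun s : ℝ => f (x + s • v)) =ᶠ[nhds 0]
      fun s => fderiv ℝ f (x + s • v) v := by
    filter_upwards [hline0.eventually (hf.eventually (by simp))] with s hs
    exact ((hs.differentiableAt two_ne_zero).hasFDerivAt.comp_hasDerivAt s (hline s)).deriv
  have hfd : HasFDerivAt (fderiv ℝ f) (fderiv ℝ (fderiv ℝ f) x) (x + (0 : ℝ) • v) := by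
    simpa using ((hf.fderiv_right (m := 1) (by norm_num)).differentiableAt
      one_ne_zero).hasFDerivAt
  have hsecond : deriv (deriv fun s : ℝ => f (x + s • v)) 0 =
      iteratedFDeriv ℝ 2 f x ![v, v] := by
    rw [hderiv.deriv_eq, iteratedFDeriv_two_apply]
    have h : HasDerivAt (fun s : ℝ => fderiv ℝ f (x + s • v)) (fderiv ℝ (fderiv ℝ f) x v) 0 :=
      hfd.comp_hasDerivAt (0 : ℝ) (hline 0)
    simpa using (h.clm_apply (hasDerivAt_const (0 : ℝ) v)).deriv
  rw [← hsecond]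
  apply IsLocalMin.deriv_deriv_nonneg
  · simpa [IsLocalMin, IsMinFilter] using hline0.eventually hmin
  · have hfx : ContinuousAt f (x + (0 : ℝ) • v) := by simpa using hf.continuousAt
    exact hfx.comp (f := fun s : ℝ => x + s • v) (hline 0).continuousAt

theorem lap_smul_sub {n : ℕ} {f g : EuclideanSpace ℝ (Fin n) → ℝ}
    {x : EuclideanSpace ℝ (Fin n)} (hf : ContDiffAt ℝ 2 f x) (hg : ContDiffAt ℝ 2 g x) (s : ℝ) :
    lap (s • f - g) x = s * lap f x - lap g x := by
  have hsf : ContDiffAt ℝ 2 (s • f) x := hf.const_smul s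
  simp only [lap, Finset.mul_sum, ← Finset.sum_sub_distrib]
  refine Finset.sum_congr rfl fun i _ => ?_
  rw [iteratedFDeriv_sub_apply hsf hg, iteratedFDeriv_const_smul_apply hf]
  simp

/-- The minimum principle for strictly superharmonic functions. -/
theorem nonneg_of_lap_neg {n : ℕ} {Ω : Set (EuclideanSpace ℝ (Fin n))}
    (hΩ_open : IsOpen Ω) (hΩ_bdd : Bornology.IsBounded Ω)
    {w : EuclideanSpace ℝ (Fin n) → ℝ} (hw : ContDiffOn ℝ 2 w (closure Ω))
    (hlap : ∀ x ∈ Ω, lap w x < 0) (hbdry : ∀ x ∈ frontier Ω, 0 ≤ w x) :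
    ∀ x ∈ Ω, 0 ≤ w x := by
  intro x hx
  obtain ⟨y, hy, hmin⟩ := hΩ_bdd.isCompact_closure.exists_isMinOn
    ⟨x, subset_closure hx⟩ hw.continuousOn
  refine le_trans ?_ (hmin (subset_closure hx))
  by_cases hyΩ : y ∈ Ω
  · have hnhds : closure Ω ∈ nhds y := mem_of_superset (hΩ_open.mem_nhds hyΩ) subset_closure
    exact absurd (hlap y hyΩ) (not_lt.mpr (Finset.sum_nonneg fun i _ =>
      (hmin.isLocalMin hnhds).iteratedFDeriv_two_nonneg (hw.contDiffAt hnhds) _))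
  · exact hbdry y (hΩ_open.frontier_eq ▸ ⟨hy, hyΩ⟩)

/-- If `φ` is a principal Dirichlet eigenfunction of `Ω` with eigenvalue
`λ₁ > 0` and `u` solves the Gelfand problem `Δu + λ e^u = 0` in `Ω` with `u = 0` on `∂Ω`
for some `λ > 0`, then `λ ≤ λ₁`. -/
theorem gelfand_lambda_le_first_eigenvalue
    (n : ℕ) (Ω : Set (EuclideanSpace ℝ (Fin n)))
    (hΩ_open : IsOpen Ω) (hΩ_bdd : Bornology.IsBounded Ω) (hΩ_conn : IsConnected Ω)
    (lam₁ : ℝ) (hlam₁ : 0 < lam₁)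
    (φ : EuclideanSpace ℝ (Fin n) → ℝ)
    (hφC2 : ContDiffOn ℝ 2 φ (closure Ω))
    (hφ_pos : ∀ x ∈ Ω, 0 < φ x)
    (hφ_bdry : ∀ x ∈ frontier Ω, φ x = 0)
    (hφ_eig : ∀ x ∈ Ω, -(lap φ x) = lam₁ * φ x)
    (lam : ℝ) (hlam : 0 < lam)
    (u : EuclideanSpace ℝ (Fin n) → ℝ)
    (hu : ContDiffOn ℝ 2 u (closure Ω))
    (heq : ∀ x ∈ Ω, lap u x + lam * exp (u x) = 0)
    (hbdry : ∀ x ∈ frontier Ω, u x = 0) :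
    lam ≤ lam₁ := by
  by_contra! hlt
  obtain ⟨x₀, hx₀⟩ := hΩ_conn.nonempty
  have hnhds : ∀ x ∈ Ω, closure Ω ∈ nhds x := fun x hx =>
    mem_of_superset (hΩ_open.mem_nhds hx) subset_closure
  have hu_nonneg : ∀ x ∈ Ω, 0 ≤ u x := by
    refine nonneg_of_lap_neg hΩ_open hΩ_bdd hu (fun x hx => ?_) fun x hx => (hbdry x hx).ge
    linarith [heq x hx, mul_pos hlam (exp_pos (u x))]
  have hcompare : ∀ s : ℝ, (∀ x ∈ Ω, lam₁ * φ x < s * lam * exp (u x)) →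
      ∀ x ∈ Ω, φ x ≤ s * u x := by
    intro s hs x hx
    have h := nonneg_of_lap_neg hΩ_open hΩ_bdd ((hu.const_smul s).sub hφC2) (fun y hy => ?_)
      (fun y hy => by simp [hbdry y hy, hφ_bdry y hy]) x hx
    · simpa using h
    · change lap (s • u - φ) y < 0
      rw [lap_smul_sub (hu.contDiffAt (hnhds y hy)) (hφC2.contDiffAt (hnhds y hy))]
      have hlap : lap u y = -(lam * exp (u y)) := by linarith [heq y hy]
      rw [hlap]
      linarith [hφ_eig y hy, hs y hy]
  obtain ⟨M, hM⟩ := hΩ_bdd.isCompact_closure.bddAbove_image hφC2.continuousOn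
  have hφM : ∀ x ∈ Ω, φ x ≤ M := fun x hx => hM (mem_image_of_mem φ (subset_closure hx))
  have hM_pos : 0 < M := (hφ_pos x₀ hx₀).trans_le (hφM x₀ hx₀)
  have hM_bound : ∀ x ∈ Ω, φ x ≤ M * u x := by
    refine hcompare M fun x hx => ?_
    calc lam₁ * φ x ≤ lam₁ * M := by gcongr; exact hφM x hx
      _ < lam * M := by gcongr
      _ = M * lam * 1 := by ring
      _ ≤ M * lam * exp (u x) := by gcongr; exact one_le_exp (hu_nonneg x hx)
  have hiter : ∀ k : ℕ, ∀ x ∈ Ω, φ x ≤ (lam₁ / lam) ^ k * M * u x := by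
    intro k
    induction k with
    | zero => simpa using hM_bound
    | succ k ih =>
      refine hcompare _ fun x hx => ?_
      have hcancel : (lam₁ / lam) ^ (k + 1) * M * lam = lam₁ * ((lam₁ / lam) ^ k * M) := by
        rw [pow_succ]; field_simp
      rw [hcancel]
      calc lam₁ * φ x ≤ lam₁ * ((lam₁ / lam) ^ k * M * u x) := by gcongr; exact ih x hx
        _ = lam₁ * ((lam₁ / lam) ^ k * M) * u x := by ring
        _ < lam₁ * ((lam₁ / lam) ^ k * M) * exp (u x) := by
          gcongr
          linarith [add_one_le_exp (u x)]
  have hlim : Tendsto (fun k : ℕ => (lam₁ / lam) ^ k * M * u x₀) atTop (nhds 0) := by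
    simpa using ((tendsto_pow_atTop_nhds_zero_of_lt_one (by positivity)
      ((div_lt_one hlam).mpr hlt)).mul_const M).mul_const (u x₀)
  exact (hφ_pos x₀ hx₀).not_ge (ge_of_tendsto' hlim fun k => hiter k x₀ hx₀)
end
end

section
/- Let n ≥ 3, let Λ be a smooth closed curve embedded in ℝⁿ, fix λ > 0 admitting a stable radial solution U of the Gelfand problem in the unit ball B^{n−1}, and set u_ε(x) := U(dist(x,Λ)/ε) on T_ε(Λ). Then there exist constants C > 0 and ε₀ > 0 such that for all ε ∈ (0,ε₀) and all x ∈ T_ε(Λ), |ε²·Δu_ε(x) + λ·e^{u_ε(x)}| ≤ C·ε. -/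
open Real MeasureTheory Metric Set Filter

noncomputable section

/-- The tubular neighbourhood of radius `ε` about a set `Λ ⊆ ℝⁿ`. -/
def tube {n : ℕ} (Λ : Set (EuclideanSpace ℝ (Fin n))) (ε : ℝ) : Set (EuclideanSpace ℝ (Fin n)) :=
  {x | Metric.infDist x Λ < ε}

open scoped RealInnerProductSpace Topology

section Radial

variable {E : Type*} [NormedAddCommGroup E] [InnerProductSpace ℝ E]

lemma hasFDerivAt_norm_of_ne_zero {z : E} (hz : z ≠ 0) :
    HasFDerivAt (fun y : E => ‖y‖) (‖z‖⁻¹ • innerSL ℝ z) z := by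
  have hz' : ‖z‖ ≠ 0 := norm_ne_zero_iff.2 hz
  have := (hasStrictFDerivAt_norm_sq z).hasFDerivAt.sqrt (pow_ne_zero 2 hz')
  simp only [Real.sqrt_sq (norm_nonneg _)] at this
  refine this.congr_fderiv ?_
  ext v
  simp
  field_simp

lemma hasFDerivAt_radial {g : ℝ → ℝ} (h0 : deriv g 0 = 0) {z : E}
    (hg : DifferentiableAt ℝ g ‖z‖) :
    HasFDerivAt (fun y : E => g ‖y‖) (dslope (deriv g) 0 ‖z‖ • innerSL ℝ z) z := by
  rcases eq_or_ne z 0 with rfl | hz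
  · have h1 : HasDerivAt g 0 0 := by simpa [h0] using hg.hasDerivAt
    have h2 : Tendsto (fun y : E => ‖y‖) (𝓝 0) (𝓝 0) := by
      simpa using continuous_norm.tendsto (0 : E)
    have h3 := (hasDerivAt_iff_isLittleO.1 h1).comp_tendsto h2
    rw [hasFDerivAt_iff_isLittleO]
    exact .of_norm_right (by simpa [Function.comp_def] using h3)
  · have hz' : ‖z‖ ≠ 0 := norm_ne_zero_iff.2 hz
    have h1 := hasFDerivAt_norm_of_ne_zero hz
    refine (hg.hasDerivAt.comp_hasFDerivAt z h1).congr_fderiv ?_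
    rw [dslope_of_ne _ hz', slope_def_field, h0, smul_smul]
    simp [div_eq_mul_inv]

lemma hasFDerivAt_norm_smul_self {φ : ℝ → ℝ} {z : E} (h0 : z = 0 → ContinuousAt φ 0)
    (hφ : z ≠ 0 → DifferentiableAt ℝ φ ‖z‖) :
    HasFDerivAt (fun y : E => φ ‖y‖ • y)
      (φ ‖z‖ • ContinuousLinearMap.id ℝ E +
        (deriv φ ‖z‖ / ‖z‖) • (innerSL ℝ z).smulRight z) z := by
  rcases eq_or_ne z 0 with rfl | hz
  · have h2 : Tendsto (fun y : E => ‖y‖) (𝓝 0) (𝓝 0) := by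
      simpa using continuous_norm.tendsto (0 : E)
    have h3 : Tendsto (fun y : E => φ ‖y‖ - φ 0) (𝓝 0) (𝓝 0) := by
      simpa using ((h0 rfl).tendsto.comp h2).sub_const (φ 0)
    have h4 := ((Asymptotics.isLittleO_one_iff ℝ).2 h3).smul_isBigO
      (Asymptotics.isBigO_refl (fun y : E => y) (𝓝 0))
    rw [hasFDerivAt_iff_isLittleO]
    simpa [sub_smul] using h4
  · have hz' : ‖z‖ ≠ 0 := norm_ne_zero_iff.2 hz
    have h1 := hasFDerivAt_norm_of_ne_zero hz
    refine (((hφ hz).hasDerivAt.comp_hasFDerivAt z h1).smul (hasFDerivAt_id z)).congr_fderiv ?_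
    ext v
    simp [div_eq_mul_inv, mul_assoc, smul_smul]

lemma deriv_dslope_zero {k : ℝ → ℝ} (h0 : k 0 = 0) {r : ℝ} (hr : r ≠ 0)
    (hk : DifferentiableAt ℝ k r) :
    deriv (dslope k 0) r * r = deriv k r - dslope k 0 r := by
  have h : dslope k 0 =ᶠ[𝓝 r] fun s => k s / s := by
    filter_upwards [dslope_eventuallyEq_slope_of_ne k hr] with s hs
    rw [hs, slope_def_field, h0]
    simp
  rw [h.deriv_eq, h.eq_of_nhds, deriv_fun_div hk differentiableAt_fun_id hr]
  simp
  field_simp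

end Radial

lemma sum_apply_single_eq {m : ℕ} (x y : EuclideanSpace ℝ (Fin m)) :
    ∑ i, ⟪x, EuclideanSpace.single i 1⟫ * ⟪y, EuclideanSpace.single i 1⟫ = ⟪x, y⟫ := by
  simp [PiLp.inner_apply, mul_comm]

/-- The Laplacian of a function of the length of a vector field `w` satisfying the eikonal
relation `(Dw)ᵀ w = c w`. -/
lemma lap_radial_comp {m : ℕ} {g : ℝ → ℝ} (h0 : deriv g 0 = 0) {R : ℝ}
    (hg : ∀ s, |s| < R → ContDiffAt ℝ 2 g s)
    {w : EuclideanSpace ℝ (Fin m) → EuclideanSpace ℝ (Fin m)} {x : EuclideanSpace ℝ (Fin m)}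
    {c : ℝ} (hwx : ‖w x‖ < R)
    {w' : EuclideanSpace ℝ (Fin m) → EuclideanSpace ℝ (Fin m) →L[ℝ] EuclideanSpace ℝ (Fin m)}
    (hw : ∀ᶠ y in 𝓝 x, HasFDerivAt w (w' y) y ∧ ∀ v, ⟪w y, w' y v⟫ = c * ⟪w y, v⟫) :
    lap (fun y => g ‖w y‖) x =
      c * (c * (deriv (deriv g) ‖w x‖ - dslope (deriv g) 0 ‖w x‖) +
        dslope (deriv g) 0 ‖w x‖ *
          ∑ i, ⟪w' x (EuclideanSpace.single i 1), EuclideanSpace.single i 1⟫) := by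
  set φ := dslope (deriv g) 0 with hφ
  have hx := hw.self_of_nhds
  have hnear : ∀ᶠ y in 𝓝 x, ‖w y‖ < R :=
    hx.1.continuousAt.norm.eventually (gt_mem_nhds hwx)
  have hgrad : fderiv ℝ (fun y => g ‖w y‖) =ᶠ[𝓝 x]
      fun y => innerSL ℝ (c • (φ ‖w y‖ • w y)) := by
    filter_upwards [hw, hnear] with y hy hyR
    have hd : DifferentiableAt ℝ g ‖w y‖ :=
      (hg _ (by rwa [abs_norm])).differentiableAt (by norm_num)
    have := (hasFDerivAt_radial h0 hd).comp y hy.1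
    refine (HasFDerivAt.fderiv this).trans ?_
    ext v
    simp [hy.2 v]
    ring
  have hd2 : ∀ s, |s| < R → DifferentiableAt ℝ (deriv g) s := fun s hs => by
    have h1 : ContDiffAt ℝ 1 (deriv g) s := by
      have := (hg s hs).fderiv_right (m := 1) (by norm_num)
      exact (this.clm_apply contDiffAt_const : ContDiffAt ℝ 1 (fun y => fderiv ℝ g y 1) s)
    exact h1.differentiableAt (by norm_num)
  have hR : |‖w x‖| < R := by rwa [abs_norm]
  have hH := hasFDerivAt_norm_smul_self (φ := φ) (z := w x)
    (fun hz => continuousAt_dslope_same.2 (hd2 0 (by simpa [hz] using hwx)))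
    (fun hz => (differentiableAt_dslope_of_ne (norm_ne_zero_iff.2 hz)).2 (hd2 _ hR))
  have hcomp := ((innerSL ℝ (E := EuclideanSpace ℝ (Fin m))).hasFDerivAt.comp x
    ((hH.comp x hx.1).const_smul c))
  have hfd : fderiv ℝ (fderiv ℝ (fun y => g ‖w y‖)) x = _ :=
    hgrad.fderiv_eq.trans hcomp.fderiv
  have hent : ∀ v, fderiv ℝ (fderiv ℝ (fun y => g ‖w y‖)) x v v =
      c * (φ ‖w x‖ * ⟪w' x v, v⟫ + deriv φ ‖w x‖ / ‖w x‖ * c * (⟪w x, v⟫ * ⟪w x, v⟫)) := by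
    intro v
    have h : fderiv ℝ (fderiv ℝ (fun y => g ‖w y‖)) x v v =
        ⟪c • (φ ‖w x‖ • w' x v + (deriv φ ‖w x‖ / ‖w x‖) • ⟪w x, w' x v⟫ • w x), v⟫ := by
      rw [hfd]
      rfl
    rw [h, hx.2 v]
    simp only [inner_smul_left, inner_add_left, conj_trivial]
    ring
  have key : deriv φ ‖w x‖ / ‖w x‖ * ⟪w x, w x⟫ = deriv (deriv g) ‖w x‖ - φ ‖w x‖ := by
    rcases eq_or_ne (w x) 0 with hz | hz
    · simp [hz, hφ]
    · have hz' : ‖w x‖ ≠ 0 := norm_ne_zero_iff.2 hz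
      rw [← deriv_dslope_zero h0 hz' (hd2 _ hR), real_inner_self_eq_norm_sq]
      field_simp
      rfl
  unfold lap
  simp only [iteratedFDeriv_two_apply, Matrix.cons_val_zero, Matrix.cons_val_one, hent]
  rw [← Finset.mul_sum, Finset.sum_add_distrib, ← Finset.mul_sum, ← Finset.mul_sum,
    sum_apply_single_eq, ← key]
  ring

/-- The even extension `g` of the profile of a radial `C²` solution of the Gelfand problem, with
the ordinary differential equation it satisfies. -/
lemma exists_even_profile {d : ℕ} [NeZero d] {lam : ℝ}
    {U : EuclideanSpace ℝ (Fin d) → ℝ} {U₀ : ℝ → ℝ}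
    (hUrad : ∀ z : EuclideanSpace ℝ (Fin d), U z = U₀ ‖z‖)
    (hUC2 : ContDiffOn ℝ 2 U (closedBall (0 : EuclideanSpace ℝ (Fin d)) 1))
    (hUsol : ∀ z ∈ ball (0 : EuclideanSpace ℝ (Fin d)) 1, lap U z + lam * exp (U z) = 0) :
    ∃ g : ℝ → ℝ, (∀ r, 0 ≤ r → g r = U₀ r) ∧ deriv g 0 = 0 ∧
      (∀ s, |s| < 1 → ContDiffAt ℝ 2 g s) ∧ (∃ K, ∀ s, |s| < 1 → |deriv g s| ≤ K) ∧
      ∀ r, 0 ≤ r → r < 1 →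
        deriv (deriv g) r - dslope (deriv g) 0 r + d * dslope (deriv g) 0 r +
          lam * exp (g r) = 0 := by
  set e : EuclideanSpace ℝ (Fin d) := EuclideanSpace.single 0 1
  have he : ‖e‖ = 1 := by simp [e]
  have hse : ∀ s : ℝ, ‖s • e‖ = |s| := fun s => by simp [norm_smul, he]
  have hg : ∀ s, U (s • e) = U₀ |s| := fun s => by rw [hUrad, hse]
  have hUat : ∀ z : EuclideanSpace ℝ (Fin d), ‖z‖ < 1 → ContDiffAt ℝ 2 U z := fun z hz =>
    hUC2.contDiffAt (mem_of_superset (isOpen_ball.mem_nhds (by simpa using hz))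
      ball_subset_closedBall)
  have hgat : ∀ s, |s| < 1 → ContDiffAt ℝ 2 (fun s : ℝ => U (s • e)) s := fun s hs =>
    (hUat (s • e) (by rwa [hse])).comp s (by fun_prop)
  have h0 : deriv (fun s : ℝ => U (s • e)) 0 = 0 := by
    have h := deriv_comp_neg (fun s : ℝ => U (s • e)) 0
    simp only [hg, abs_neg, neg_zero] at h ⊢
    linarith
  have hUg : U = fun z => (fun s : ℝ => U (s • e)) ‖z‖ := by
    funext z
    simp only [hg, abs_norm]
    exact hUrad z
  refine ⟨fun s => U (s • e), fun r hr => by simp only [hg, abs_of_nonneg hr], h0, hgat, ?_, ?_⟩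
  · have hcont : ContinuousOn (fderivWithin ℝ U (closedBall 0 1))
        (closedBall (0 : EuclideanSpace ℝ (Fin d)) 1) := by
      refine hUC2.continuousOn_fderivWithin (uniqueDiffOn_convex (convex_closedBall 0 1) ?_)
        (by norm_num)
      rw [interior_closedBall _ one_ne_zero]
      exact nonempty_ball.2 one_pos
    obtain ⟨K, hK⟩ := (isCompact_closedBall _ _).exists_bound_of_continuousOn hcont
    refine ⟨K, fun s hs => ?_⟩
    have hs' : ‖s • e‖ < 1 := by rwa [hse]
    have h1 : HasDerivAt (fun s : ℝ => U (s • e)) (fderiv ℝ U (s • e) e) s := by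
      have h2 : HasDerivAt (fun s : ℝ => s • e) e s := by
        simpa using (hasDerivAt_id s).smul_const e
      exact ((hUat _ hs').differentiableAt (by norm_num)).hasFDerivAt.comp_hasDerivAt s h2
    have h3 := hK (s • e) (by simpa using hs'.le)
    rw [fderivWithin_of_mem_nhds (mem_of_superset (isOpen_ball.mem_nhds (by simpa using hs'))
      ball_subset_closedBall)] at h3
    rw [h1.deriv, ← Real.norm_eq_abs]
    simpa [he] using (ContinuousLinearMap.le_of_opNorm_le _ h3 e)
  · intro r hr hr1
    have hre : ‖r • e‖ = r := by rw [hse, abs_of_nonneg hr]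
    have h := lap_radial_comp (m := d) h0 hgat (w := id) (x := r • e) (c := 1)
      (w' := fun _ => ContinuousLinearMap.id ℝ _) (by simpa [hre] using hr1)
      (Eventually.of_forall fun y => ⟨hasFDerivAt_id y, fun v => by simp⟩)
    have hs := hUsol (r • e) (by simpa [hre] using hr1)
    rw [show lap U (r • e) = _ from (congrArg (lap · (r • e)) hUg).trans h] at hs
    simp only [id, hre, one_mul] at hs
    refine Eq.trans ?_ hs
    simp [mul_comm]

section ClosedCurve

variable {E : Type*} [NormedAddCommGroup E] {γ : ℝ → E}

lemma Function.Periodic.exists_norm_le (hper : Function.Periodic γ 1) (hγ : Continuous γ) :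
    ∃ K, ∀ t, ‖γ t‖ ≤ K := by
  obtain ⟨K, hK⟩ := (hper.compact_of_continuous one_ne_zero hγ).isBounded.exists_norm_le
  exact ⟨K, fun t => hK _ (mem_range_self t)⟩

lemma Function.Periodic.exists_pos_le_norm (hper : Function.Periodic γ 1) (hγ : Continuous γ)
    (h0 : ∀ t, γ t ≠ 0) : ∃ m > 0, ∀ t, m ≤ ‖γ t‖ := by
  obtain ⟨_, ⟨t₀, rfl⟩, ht₀⟩ := (hper.compact_of_continuous one_ne_zero hγ).exists_isMinOn
    (range_nonempty γ) continuous_norm.continuousOn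
  exact ⟨‖γ t₀‖, norm_pos_iff.2 (h0 t₀), fun t => ht₀ (mem_range_self t)⟩

lemma exists_norm_sub_eq_infDist (hper : Function.Periodic γ 1) (hγ : Continuous γ) (x : E) :
    ∃ t, ‖x - γ t‖ = infDist x (range γ) := by
  obtain ⟨_, ⟨t, rfl⟩, ht⟩ := (hper.compact_of_continuous one_ne_zero hγ).exists_infDist_eq_dist
    (range_nonempty γ) x
  exact ⟨t, by rw [ht, dist_eq_norm]⟩

/-- Parameters of nearby points of a simple closed curve are close modulo the period. -/
lemma exists_pos_forall_abs_sub_lt (hper : Function.Periodic γ 1) (hγ : Continuous γ)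
    (hinj : ∀ s t : ℝ, γ s = γ t → ∃ k : ℤ, s - t = k) {η : ℝ} (hη : 0 < η) :
    ∃ ρ > 0, ∀ s t, |s - t| ≤ 1 / 2 → ‖γ s - γ t‖ < ρ → |s - t| < η := by
  set S : Set (ℝ × ℝ) := (Icc (-1 / 2) (1 / 2) ×ˢ Icc 0 1) ∩ {q | η ≤ |q.1|}
  have hS : IsCompact S := (isCompact_Icc.prod isCompact_Icc).inter_right
    (isClosed_le continuous_const (by fun_prop))
  have hcont : Continuous fun q : ℝ × ℝ => ‖γ (q.1 + q.2) - γ q.2‖ := by fun_prop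
  have hpos : ∀ q ∈ S, 0 < ‖γ (q.1 + q.2) - γ q.2‖ := by
    rintro ⟨u, t⟩ ⟨⟨⟨hu1, hu2⟩, -⟩, hu⟩
    simp only at hu1 hu2
    have hu : η ≤ |u| := hu
    refine norm_pos_iff.2 (sub_ne_zero.2 fun h => ?_)
    obtain ⟨k, hk⟩ := hinj _ _ h
    have hk : u = k := by simpa using hk
    have h1 : |(k : ℝ)| < 1 := by
      rw [← hk, abs_lt]
      constructor <;> linarith
    have h2 : k = 0 := by
      have : |k| < 1 := by exact_mod_cast h1
      exact Int.abs_lt_one_iff.1 this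
    rw [hk, h2] at hu
    simp at hu
    linarith
  obtain ⟨ρ, hρ, hρS⟩ : ∃ ρ > 0, ∀ q ∈ S, ρ ≤ ‖γ (q.1 + q.2) - γ q.2‖ := by
    rcases S.eq_empty_or_nonempty with he | hne
    · exact ⟨1, one_pos, by simp [he]⟩
    · obtain ⟨q, hq, hmin⟩ := hS.exists_isMinOn hne hcont.continuousOn
      exact ⟨_, hpos q hq, fun r hr => hmin hr⟩
  refine ⟨ρ, hρ, fun s t hst hlt => ?_⟩
  by_contra! hle
  have hper' : ∀ u, γ (u - ⌊t⌋) = γ u := fun u => by simpa using hper.sub_int_mul_eq (x := u) ⌊t⌋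
  obtain ⟨hst1, hst2⟩ := abs_le.1 hst
  have := hρS (s - t, Int.fract t) ⟨⟨⟨by linarith, hst2⟩,
    Int.fract_nonneg t, (Int.fract_lt_one t).le⟩, hle⟩
  have e1 : s - t + Int.fract t = s - ⌊t⌋ := by
    rw [← Int.self_sub_floor]
    ring
  simp only [e1, hper'] at this
  rw [← Int.self_sub_floor, hper'] at this
  linarith

variable [InnerProductSpace ℝ E]

lemma inner_deriv_eq_zero_of_norm_sub_eq_infDist (hγ : Differentiable ℝ γ) {x : E} {t : ℝ}
    (ht : ‖x - γ t‖ = infDist x (range γ)) : ⟪x - γ t, deriv γ t⟫ = 0 := by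
  have hmin : IsLocalMin (fun s => ‖x - γ s‖ ^ 2) t := Eventually.of_forall fun s => by
    have : ‖x - γ t‖ ≤ ‖x - γ s‖ := by
      rw [ht, ← dist_eq_norm]
      exact infDist_le_dist_of_mem (mem_range_self s)
    simp only
    gcongr
  have hd := ((hγ t).hasDerivAt.const_sub x).norm_sq
  simpa using hmin.hasDerivAt_eq_zero hd

lemma hasDerivAt_inner_sub_deriv (hγ : ContDiff ℝ 2 γ) (y : E) (s : ℝ) :
    HasDerivAt (fun s => ⟪y - γ s, deriv γ s⟫)
      (-(‖deriv γ s‖ ^ 2 - ⟪y - γ s, deriv (deriv γ) s⟫)) s := by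
  have h1 := ((hγ.differentiable (by norm_num)) s).hasDerivAt.const_sub y
  have h2 := ((hγ.differentiable_deriv_two) s).hasDerivAt
  refine (h1.inner ℝ h2).congr_deriv ?_
  rw [inner_neg_left, real_inner_self_eq_norm_sq]
  ring

lemma eq_of_inner_sub_deriv_eq_zero (hγ : ContDiff ℝ 2 γ) {y : E} {a b s t : ℝ}
    (hneg : ∀ r ∈ Icc a b, 0 < ‖deriv γ r‖ ^ 2 - ⟪y - γ r, deriv (deriv γ) r⟫)
    (hs : s ∈ Icc a b) (ht : t ∈ Icc a b) (hs0 : ⟪y - γ s, deriv γ s⟫ = 0)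
    (ht0 : ⟪y - γ t, deriv γ t⟫ = 0) : s = t := by
  have hanti : StrictAntiOn (fun r => ⟪y - γ r, deriv γ r⟫) (Icc a b) := by
    refine strictAntiOn_of_deriv_neg (convex_Icc a b)
      (fun r _ => (hasDerivAt_inner_sub_deriv hγ y r).continuousAt.continuousWithinAt) fun r hr => ?_
    rw [(hasDerivAt_inner_sub_deriv hγ y r).deriv]
    linarith [hneg r (interior_subset hr)]
  exact hanti.injOn hs ht (hs0.trans ht0.symm)

lemma exists_implicit_param [CompleteSpace E] (hγ : ContDiff ℝ 2 γ) {x : E} {t₀ : ℝ}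
    (h0 : ⟪x - γ t₀, deriv γ t₀⟫ = 0)
    (hA : 0 < ‖deriv γ t₀‖ ^ 2 - ⟪x - γ t₀, deriv (deriv γ) t₀⟫) :
    ∃ τ : E → ℝ, τ x = t₀ ∧
      HasFDerivAt τ ((‖deriv γ t₀‖ ^ 2 - ⟪x - γ t₀, deriv (deriv γ) t₀⟫)⁻¹ •
        innerSL ℝ (deriv γ t₀)) x ∧
      ∀ᶠ y in 𝓝 x, ⟪y - γ (τ y), deriv γ (τ y)⟫ = 0 := by
  set A := ‖deriv γ t₀‖ ^ 2 - ⟪x - γ t₀, deriv (deriv γ) t₀⟫ with hAdef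
  set F : E × ℝ → ℝ := fun q => ⟪q.1 - γ q.2, deriv γ q.2⟫
  have hγ1 : HasStrictFDerivAt (fun q : E × ℝ => γ q.2)
      ((ContinuousLinearMap.snd ℝ E ℝ).smulRight (deriv γ t₀)) (x, t₀) := by
    have h : HasStrictDerivAt γ (deriv γ t₀) t₀ :=
      (hγ.contDiffAt (x := t₀)).hasStrictDerivAt (by norm_num)
    refine (h.hasStrictFDerivAt.comp (x, t₀) hasStrictFDerivAt_snd).congr_fderiv ?_
    ext <;> simp
  have hγ2 : HasStrictFDerivAt (fun q : E × ℝ => deriv γ q.2)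
      ((ContinuousLinearMap.snd ℝ E ℝ).smulRight (deriv (deriv γ) t₀)) (x, t₀) := by
    have h2 : ContDiff ℝ 1 (deriv γ) := ((contDiff_succ_iff_deriv (n := 1)).1 hγ).2.2
    have h : HasStrictDerivAt (deriv γ) (deriv (deriv γ) t₀) t₀ :=
      (h2.contDiffAt (x := t₀)).hasStrictDerivAt (by norm_num)
    refine (h.hasStrictFDerivAt.comp (x, t₀) hasStrictFDerivAt_snd).congr_fderiv ?_
    ext <;> simp
  have hF := (hasStrictFDerivAt_fst.sub hγ1).inner ℝ hγ2
  have hF' : HasStrictFDerivAt F ((innerSL ℝ (deriv γ t₀)).comp (.fst ℝ E ℝ) -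
      A • .snd ℝ E ℝ) (x, t₀) := by
    refine hF.congr_fderiv ?_
    ext v
    · simp [fderivInnerCLM_apply, real_inner_comm]
    · simp [fderivInnerCLM_apply, hAdef]
      ring
  have hinv : (((innerSL ℝ (deriv γ t₀)).comp (.fst ℝ E ℝ) - A • .snd ℝ E ℝ) ∘L
      .inr ℝ E ℝ).IsInvertible := by
    refine ⟨ContinuousLinearEquiv.unitsEquivAut ℝ (Units.mk0 (-A) (by linarith)), ?_⟩
    ext
    simp
  have hev := hF'.eventually_apply_implicitFunctionOfProdDomain hinv
  obtain ⟨T, hd⟩ : ∃ T : E →L[ℝ] ℝ, HasFDerivAt (hF'.implicitFunctionOfProdDomain hinv) T x :=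
    ⟨_, (hF'.hasStrictFDerivAt_implicitFunctionOfProdDomain hinv).hasFDerivAt⟩
  have hx := (hF'.eventually_apply_eq_iff_implicitFunctionOfProdDomain hinv).self_of_nhds.mp rfl
  set τ := hF'.implicitFunctionOfProdDomain hinv
  simp only at hx hd hev
  have hev' : ∀ᶠ y in 𝓝 x, F (y, τ y) = 0 := hev.mono fun y hy => hy.trans h0
  refine ⟨τ, hx, ?_, hev'⟩
  have hcomp := (hx ▸ hF'.hasFDerivAt :
    HasFDerivAt F _ (x, τ x)).comp x ((hasFDerivAt_id x).prodMk hd)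
  have hz := hcomp.unique ((hasFDerivAt_const (0 : ℝ) x).congr_of_eventuallyEq hev')
  refine hd.congr_fderiv ?_
  ext v
  have hv := congrArg (fun L : E →L[ℝ] ℝ => L v) hz
  simp [hx] at hv
  simp
  field_simp
  linarith

end ClosedCurve

section NearestPoint

variable {E : Type*} [NormedAddCommGroup E] [InnerProductSpace ℝ E] [CompleteSpace E] {γ : ℝ → E}

/-- Near a simple closed regular curve, a nearest-point projection is differentiable. -/
lemma exists_nearest_param_hasFDerivAt (hγ : ContDiff ℝ 2 γ) (hper : Function.Periodic γ 1)
    (hreg : ∀ t, deriv γ t ≠ 0) (hinj : ∀ s t : ℝ, γ s = γ t → ∃ k : ℤ, s - t = k) :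
    ∃ δ > 0, ∃ m > 0, ∃ K, ∃ p : E → ℝ, ∀ x, infDist x (range γ) < δ →
      ‖x - γ (p x)‖ = infDist x (range γ) ∧
      ⟪x - γ (p x), deriv γ (p x)⟫ = 0 ∧
      ‖deriv (deriv γ) (p x)‖ ≤ K ∧
      m ≤ ‖deriv γ (p x)‖ ^ 2 - ⟪x - γ (p x), deriv (deriv γ) (p x)⟫ ∧
      HasFDerivAt (fun y => γ (p y))
        (((‖deriv γ (p x)‖ ^ 2 - ⟪x - γ (p x), deriv (deriv γ) (p x)⟫)⁻¹ •
          innerSL ℝ (deriv γ (p x))).smulRight (deriv γ (p x))) x := by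
  have hdiff : Differentiable ℝ γ := hγ.differentiable (by norm_num)
  have hc : Continuous γ := hγ.continuous
  have hper1 : Function.Periodic (deriv γ) 1 := fun t => by
    rw [← deriv_comp_add_const]
    exact congrArg (deriv · t) (funext hper)
  have hper2 : Function.Periodic (deriv (deriv γ)) 1 := fun t => by
    rw [← deriv_comp_add_const]
    exact congrArg (deriv · t) (funext hper1)
  have hγ' : ContDiff ℝ 1 (deriv γ) := ((contDiff_succ_iff_deriv (n := 1)).1 hγ).2.2
  have hc1 : Continuous (deriv γ) := hγ'.continuous
  have hc2 : Continuous (deriv (deriv γ)) := hγ'.continuous_deriv le_rfl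
  obtain ⟨m, hm, hmle⟩ := hper1.exists_pos_le_norm hc1 hreg
  obtain ⟨K₁, hK₁⟩ := hper1.exists_norm_le hc1
  obtain ⟨K₂, hK₂⟩ := hper2.exists_norm_le hc2
  have hK₁0 : 0 ≤ K₁ := (norm_nonneg _).trans (hK₁ 0)
  have hK₂0 : 0 ≤ K₂ := (norm_nonneg _).trans (hK₂ 0)
  have hlip : ∀ s t, ‖γ s - γ t‖ ≤ K₁ * |s - t| := fun s t => by
    simpa using convex_univ.norm_image_sub_le_of_norm_deriv_le
      (fun r _ => hdiff r) (fun r _ => hK₁ r) (mem_univ t) (mem_univ s)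
  set r₀ : ℝ := m ^ 2 / (2 * (K₂ + 1)) with hr₀
  have hr₀pos : 0 < r₀ := by positivity
  have hconvex : ∀ y s, ‖y - γ s‖ ≤ r₀ →
      m ^ 2 / 2 ≤ ‖deriv γ s‖ ^ 2 - ⟪y - γ s, deriv (deriv γ) s⟫ := fun y s hy => by
    have h1 : ⟪y - γ s, deriv (deriv γ) s⟫ ≤ r₀ * (K₂ + 1) :=
      (real_inner_le_norm _ _).trans (mul_le_mul hy ((hK₂ s).trans (by linarith))
        (norm_nonneg _) hr₀pos.le)
    have h2 : r₀ * (K₂ + 1) = m ^ 2 / 2 := by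
      rw [hr₀]
      field_simp
    have h3 : m ^ 2 ≤ ‖deriv γ s‖ ^ 2 := by
      gcongr
      exact hmle s
    linarith
  set η : ℝ := r₀ / (4 * (K₁ + 1)) with hηdef
  have hη : 0 < η := by positivity
  have hK₁η : K₁ * η ≤ r₀ / 4 := by
    rw [hηdef, mul_div_assoc', div_le_div_iff₀ (by positivity) (by norm_num)]
    nlinarith
  obtain ⟨ρ, hρ, hsep⟩ := exists_pos_forall_abs_sub_lt hper hc hinj hη
  set δ : ℝ := min (r₀ / 4) (ρ / 4)
  have hδ : 0 < δ := by positivity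
  have hδr : δ ≤ r₀ / 4 := min_le_left _ _
  have hδρ : δ ≤ ρ / 4 := min_le_right _ _
  choose p hp using exists_norm_sub_eq_infDist hper hc
  have hcrit := fun x => inner_deriv_eq_zero_of_norm_sub_eq_infDist hdiff (hp x)
  refine ⟨δ, hδ, m ^ 2 / 2, by positivity, K₂, p, fun x hx => ?_⟩
  have hpx : ‖x - γ (p x)‖ < δ := (hp x).trans_lt hx
  have hA := hconvex x (p x) (by linarith)
  refine ⟨hp x, hcrit x, hK₂ _, hA, ?_⟩
  obtain ⟨τ, hτx, hτ', hτ⟩ := exists_implicit_param hγ (hcrit x) (hA.trans_lt' (by positivity))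
  have hτnear : ∀ᶠ y in 𝓝 x, |τ y - p x| < η := by
    have := hτ'.continuousAt.tendsto.eventually (Metric.ball_mem_nhds (τ x) hη)
    simpa [hτx, Real.dist_eq] using this
  have hynear : ∀ᶠ y in 𝓝 x, ‖y - x‖ < δ := by
    filter_upwards [Metric.ball_mem_nhds x hδ] with y hy
    rwa [← dist_eq_norm]
  have hydist : ∀ᶠ y in 𝓝 x, infDist y (range γ) < δ :=
    (continuous_infDist_pt _).continuousAt.eventually (gt_mem_nhds hx)
  have heq : (fun y => γ (p y)) =ᶠ[𝓝 x] fun y => γ (τ y) := by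
    filter_upwards [hτ, hτnear, hynear, hydist] with y hy1 hy2 hy3 hy4
    set k : ℤ := round (p y - p x) with hk
    set s : ℝ := p y - k with hs
    have hγs : γ s = γ (p y) := by simpa using hper.sub_int_mul_eq (x := p y) k
    have hγ's : deriv γ s = deriv γ (p y) := by simpa using hper1.sub_int_mul_eq (x := p y) k
    have hsx : |s - p x| ≤ 1 / 2 := by
      have := abs_sub_round (p y - p x)
      rwa [← hk, show p y - p x - k = s - p x by rw [hs]; ring] at this
    have hclose : ‖γ s - γ (p x)‖ < ρ := by
      have e : γ s - γ (p x) = (y - x) + (x - γ (p x)) - (y - γ s) := by abel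
      have h1 : ‖y - γ s‖ < δ := by rw [hγs, hp y]; exact hy4
      rw [e]
      have h2 := norm_sub_le ((y - x) + (x - γ (p x))) (y - γ s)
      have h3 := norm_add_le (y - x) (x - γ (p x))
      linarith
    have hsη := hsep s (p x) hsx hclose
    have hmem : ∀ u, |u - p x| < η → u ∈ Icc (p x - η) (p x + η) := fun u hu => by
      obtain ⟨h1, h2⟩ := abs_lt.1 hu
      exact ⟨by linarith, by linarith⟩
    have hst : s = τ y := by
      refine eq_of_inner_sub_deriv_eq_zero hγ (y := y) (fun r hr => ?_) (hmem s hsη)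
        (hmem (τ y) hy2) (by rw [hγs, hγ's]; exact hcrit y) hy1
      refine (hconvex y r ?_).trans_lt' (by positivity)
      have e : y - γ r = (y - x) + (x - γ (p x)) + (γ (p x) - γ r) := by abel
      have h1 : |p x - r| ≤ η := abs_le.2 ⟨by linarith [hr.2], by linarith [hr.1]⟩
      have h2 : K₁ * |p x - r| ≤ K₁ * η := by gcongr
      rw [e]
      refine (norm_add₃_le).trans ?_
      linarith [hlip (p x) r]
    rw [← hγs, hst]
  have hγτ : HasFDerivAt (fun y => γ (τ y)) _ x :=
    (hτx ▸ (hdiff (p x)).hasDerivAt : HasDerivAt γ (deriv γ (p x)) (τ x)).hasFDerivAt.comp x hτ'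
  refine (hγτ.congr_of_eventuallyEq heq).congr_fderiv ?_
  ext v
  simp [smul_smul]

end NearestPoint


/-- With `U` the radial stable solution (of radial profile `U₀`) of the
Gelfand problem in `B^{n-1}` and `u_ε(x) = U(dist(x,Λ)/ε)`, there are `C > 0` and
`ε₀ > 0` such that `|ε² Δu_ε + λ e^{u_ε}| ≤ C ε` on `T_ε(Λ)` for all `ε ∈ (0,ε₀)`. -/
theorem tube_approximate_solution_estimate
    (n : ℕ) (hn : 3 ≤ n)
    -- `Λ = range γ` is a smooth closed curve embedded in `ℝⁿ`
    (γ : ℝ → EuclideanSpace ℝ (Fin n)) (hγ_smooth : ContDiff ℝ (⊤ : ℕ∞) γ)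
    (hγ_per : Function.Periodic γ 1)
    (hγ_reg : ∀ t : ℝ, deriv γ t ≠ 0)
    (hγ_inj : ∀ s t : ℝ, γ s = γ t → ∃ k : ℤ, s - t = (k : ℝ))
    (Λ : Set (EuclideanSpace ℝ (Fin n))) (hΛ : Λ = Set.range γ)
    (lam : ℝ) (hlam : 0 < lam)
    -- `U` is a radial stable solution of the Gelfand problem in `B^{n-1}`, of profile `U₀`
    (U : EuclideanSpace ℝ (Fin (n - 1)) → ℝ) (U₀ : ℝ → ℝ)
    (hUrad : ∀ z : EuclideanSpace ℝ (Fin (n - 1)), U z = U₀ ‖z‖)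
    (hUC2 : ContDiffOn ℝ 2 U (closedBall (0 : EuclideanSpace ℝ (Fin (n - 1))) 1))
    (hUsol : ∀ z ∈ ball (0 : EuclideanSpace ℝ (Fin (n - 1))) 1, lap U z + lam * exp (U z) = 0)
    (hUbdry : ∀ z ∈ sphere (0 : EuclideanSpace ℝ (Fin (n - 1))) 1, U z = 0)
    (hUstab : ∀ φ : EuclideanSpace ℝ (Fin (n - 1)) → ℝ, ContDiff ℝ 1 φ → HasCompactSupport φ →
      tsupport φ ⊆ ball (0 : EuclideanSpace ℝ (Fin (n - 1))) 1 →
      lam * ∫ z in ball (0 : EuclideanSpace ℝ (Fin (n - 1))) 1, exp (U z) * φ z ^ 2 ≤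
        ∫ z in ball (0 : EuclideanSpace ℝ (Fin (n - 1))) 1, ‖gradient φ z‖ ^ 2) :
    ∃ C > (0 : ℝ), ∃ ε₀ > (0 : ℝ), ∀ ε : ℝ, 0 < ε → ε < ε₀ →
      ∀ x ∈ tube Λ ε,
        |ε ^ 2 * lap (fun y => U₀ (Metric.infDist y Λ / ε)) x +
            lam * exp (U₀ (Metric.infDist x Λ / ε))| ≤ C * ε := by
  subst hΛ
  have : NeZero (n - 1) := ⟨by omega⟩
  obtain ⟨g, hgU, hg0, hg2, ⟨K, hK⟩, hode⟩ := exists_even_profile hUrad hUC2 hUsol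
  have hγ2 : ContDiff ℝ 2 γ := contDiff_infty.1 hγ_smooth 2
  obtain ⟨δ, hδ, m, hm, K₂, p, hp⟩ :=
    exists_nearest_param_hasFDerivAt hγ2 hγ_per hγ_reg hγ_inj
  have hK0 : 0 ≤ K := (abs_nonneg _).trans (hK 0 (by simp))
  have hK₂0 : 0 ≤ K₂ := by
    have h := hp (γ 0) (by rwa [infDist_zero_of_mem (mem_range_self 0)])
    exact (norm_nonneg _).trans h.2.2.1
  refine ⟨K * (K₂ / m) + 1, by positivity, δ, hδ, fun ε hε hεδ x hx => ?_⟩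
  have hx : infDist x (range γ) < ε := hx
  have hxδ := hx.trans hεδ
  obtain ⟨hdist, hcrit, hK₂x, hA, -⟩ := hp x hxδ
  set w : EuclideanSpace ℝ (Fin n) → EuclideanSpace ℝ (Fin n) := fun y => ε⁻¹ • (y - γ (p y))
  set A : EuclideanSpace ℝ (Fin n) → ℝ :=
    fun y => ‖deriv γ (p y)‖ ^ 2 - ⟪y - γ (p y), deriv (deriv γ) (p y)⟫ with hAdef
  set w' : EuclideanSpace ℝ (Fin n) → EuclideanSpace ℝ (Fin n) →L[ℝ] EuclideanSpace ℝ (Fin n) :=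
    fun y => ε⁻¹ • (ContinuousLinearMap.id ℝ _ -
      ((A y)⁻¹ • innerSL ℝ (deriv γ (p y))).smulRight (deriv γ (p y)))
  have hnear : ∀ᶠ y in 𝓝 x, infDist y (range γ) < δ :=
    (continuous_infDist_pt _).continuousAt.eventually (gt_mem_nhds hxδ)
  have hwnorm : ∀ y, infDist y (range γ) < δ → ‖w y‖ = infDist y (range γ) / ε := fun y hy => by
    simp only [w, norm_smul, (hp y hy).1, norm_inv, Real.norm_eq_abs, abs_of_pos hε]
    rw [div_eq_inv_mul]
  have hw : ∀ᶠ y in 𝓝 x, HasFDerivAt w (w' y) y ∧ ∀ v, ⟪w y, w' y v⟫ = ε⁻¹ * ⟪w y, v⟫ := by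
    filter_upwards [hnear] with y hy
    obtain ⟨-, hc, -, -, hd⟩ := hp y hy
    refine ⟨((hasFDerivAt_id y).sub hd).const_smul ε⁻¹, fun v => ?_⟩
    simp [w, w', inner_smul_left, inner_smul_right, inner_sub_right, hc]
  have hfun : (fun y => U₀ (infDist y (range γ) / ε)) =ᶠ[𝓝 x] fun y => g ‖w y‖ := by
    filter_upwards [hnear] with y hy
    rw [hwnorm y hy, hgU _ (div_nonneg infDist_nonneg hε.le)]
  set r := infDist x (range γ) / ε with hr
  have hr0 : 0 ≤ r := div_nonneg infDist_nonneg hε.le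
  have hr1 : r < 1 := (div_lt_one hε).2 hx
  have hlap := lap_radial_comp hg0 hg2 (by rwa [hwnorm x hxδ]) hw
  rw [hwnorm x hxδ, ← hr] at hlap
  have htrace : ∑ i, ⟪w' x (EuclideanSpace.single i 1), EuclideanSpace.single i 1⟫ =
      ε⁻¹ * (n - (A x)⁻¹ * ‖deriv γ (p x)‖ ^ 2) := by
    rw [← real_inner_self_eq_norm_sq, ← sum_apply_single_eq, Finset.mul_sum,
      show (n : ℝ) = ∑ _i : Fin n, (1 : ℝ) by simp, ← Finset.sum_sub_distrib, Finset.mul_sum]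
    refine Finset.sum_congr rfl fun i _ => ?_
    simp [w', inner_smul_left, inner_sub_left, mul_assoc]
  have hlap' : lap (fun y => U₀ (infDist y (range γ) / ε)) x = lap (fun y => g ‖w y‖) x := by
    simp only [lap, iteratedFDeriv_two_apply, hfun.fderiv.fderiv_eq]
  have hAx : 0 < A x := hm.trans_le hA
  have hode' := hode r hr0 hr1
  rw [Nat.cast_sub (by omega), Nat.cast_one] at hode'
  set φ := dslope (deriv g) 0 r
  have hφr : r * φ = deriv g r := by
    have := sub_smul_dslope (deriv g) 0 r
    simpa [hg0] using this
  set I := ⟪x - γ (p x), deriv (deriv γ) (p x)⟫ with hI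
  have hexpr : ε ^ 2 * lap (fun y => U₀ (infDist y (range γ) / ε)) x + lam * exp (U₀ r) =
      -(φ * (I / A x)) := by
    have hN : ‖deriv γ (p x)‖ ^ 2 = A x + I := by simp [hAdef, hI]
    rw [hlap', hlap, htrace, hN, ← hgU r hr0, ← sub_eq_zero, ← hode']
    field_simp
    ring
  have hIle : |I| ≤ ε * r * K₂ := by
    have h1 : ε * r = ‖x - γ (p x)‖ := by rw [hdist, hr]; field_simp
    rw [h1]
    exact (abs_real_inner_le_norm _ _).trans (by gcongr)
  rw [hexpr, abs_neg, abs_mul, abs_div, abs_of_pos hAx]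
  calc |φ| * (|I| / A x) ≤ |φ| * (ε * r * K₂ / m) := by gcongr
    _ = |deriv g r| * (K₂ / m) * ε := by
      rw [← hφr, abs_mul, abs_of_nonneg hr0]
      ring
    _ ≤ K * (K₂ / m) * ε := by
      gcongr
      exact hK r (by rwa [abs_of_nonneg hr0])
    _ ≤ (K * (K₂ / m) + 1) * ε := by gcongr; linarith
end
end

section
/- Let n ≥ 3, let Λ be a smooth closed curve embedded in ℝⁿ, fix λ > 0 admitting a stable radial solution U of the Gelfand problem in B^{n−1}, let W be the radial solution of −ΔW − λe^U W = 1 in B^{n−1} with W = 0 on ∂B^{n−1}, and set u_ε(x) := U(dist(x,Λ)/ε), w_ε(x) := W(dist(x,Λ)/ε) on T_ε(Λ). Then for all sufficiently small ε > 0 and all x ∈ T_ε(Λ), ε²·Δw_ε(x) + λ·e^{u_ε(x)}·w_ε(x) ≤ −1/2. -/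
open Real MeasureTheory Metric Set Filter

noncomputable section

open scoped Topology

theorem exists_param_near_of_dist_lt {E : Type*} [NormedAddCommGroup E] {γ : ℝ → E} (hγ : Continuous γ)
    (hper : Function.Periodic γ 1)
    (hinj : ∀ s t : ℝ, γ s = γ t → ∃ k : ℤ, s - t = (k : ℝ)) (t₀ : ℝ) {r : ℝ} (hr : 0 < r) :
    ∃ δ > 0, ∀ s, dist (γ s) (γ t₀) < δ → ∃ s', γ s' = γ s ∧ dist s' t₀ < r := by
  have hK : IsCompact (Icc (t₀ - 1 / 2) (t₀ + 1 / 2) \ ball t₀ r) :=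
    isCompact_Icc.diff isOpen_ball
  have hp : γ t₀ ∉ γ '' (Icc (t₀ - 1 / 2) (t₀ + 1 / 2) \ ball t₀ r) := by
    rintro ⟨s, ⟨⟨h1, h2⟩, h3⟩, hs⟩
    obtain ⟨k, hk⟩ := hinj s t₀ hs
    have h4 : (k : ℝ) < 1 := by linarith
    have h5 : (-1 : ℝ) < k := by linarith
    have h6 : k < 1 := by exact_mod_cast h4
    have h7 : -1 < k := by exact_mod_cast h5
    have h8 : k = 0 := by omega
    apply h3
    rw [mem_ball, Real.dist_eq, hk, h8]
    simpa using hr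
  obtain ⟨δ, hδ, hball⟩ := Metric.isOpen_iff.1 (hK.image hγ).isClosed.isOpen_compl _ hp
  refine ⟨δ, hδ, fun s hs => ⟨s - round (s - t₀), ?_, ?_⟩⟩
  · simpa using hper.sub_int_mul_eq (round (s - t₀)) (x := s)
  · by_contra hcon
    have heq : γ (s - round (s - t₀)) = γ s := by
      simpa using hper.sub_int_mul_eq (round (s - t₀)) (x := s)
    have habs := abs_le.1 (abs_sub_round (s - t₀))
    refine hball (mem_ball.2 hs) ⟨s - round (s - t₀), ⟨⟨?_, ?_⟩, hcon⟩, heq⟩ <;> linarith [habs.1, habs.2]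

theorem exists_infDist_range_eq_dist {E : Type*} [NormedAddCommGroup E]
    {γ : ℝ → E} (hγ : Continuous γ) (hper : Function.Periodic γ 1)
    (y : E) : ∃ s, infDist y (range γ) = dist y (γ s) := by
  have hc : IsCompact (range γ) := by
    rw [← hper.image_Icc one_pos 0]
    exact isCompact_Icc.image hγ
  obtain ⟨_, ⟨s, rfl⟩, hs⟩ := hc.exists_infDist_eq_dist (range_nonempty γ) y
  exact ⟨s, hs⟩

theorem inner_sub_deriv_eq_zero_of_infDist_eq {E : Type*} [NormedAddCommGroup E] [InnerProductSpace ℝ E]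
    {γ : ℝ → E} {y : E} {s : ℝ}
    (hγ : DifferentiableAt ℝ γ s) (hs : infDist y (range γ) = dist y (γ s)) :
    inner ℝ (y - γ s) (deriv γ s) = 0 := by
  have hd : HasDerivAt (fun t => ‖y - γ t‖ ^ 2) (2 * inner ℝ (y - γ s) (-deriv γ s)) s :=
    (hγ.hasDerivAt.const_sub y).norm_sq
  have hmin : IsLocalMin (fun t => ‖y - γ t‖ ^ 2) s := by
    refine Eventually.of_forall fun t => ?_
    have := infDist_le_dist_of_mem (x := y) (mem_range_self (f := γ) t)
    rw [hs, dist_eq_norm, dist_eq_norm] at this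
    exact pow_le_pow_left₀ (norm_nonneg _) this 2
  have := hmin.hasDerivAt_eq_zero hd
  rw [inner_neg_right] at this
  linarith

theorem exists_contDiffAt_footpoint {E : Type*} [NormedAddCommGroup E] [InnerProductSpace ℝ E]
    [CompleteSpace E] {γ : ℝ → E} (hγ : ContDiff ℝ 3 γ)
    (hper : Function.Periodic γ 1) (hreg : ∀ t : ℝ, deriv γ t ≠ 0)
    (hinj : ∀ s t : ℝ, γ s = γ t → ∃ k : ℤ, s - t = (k : ℝ)) (t₀ : ℝ) :
    ∃ τ : E → ℝ, ContDiffAt ℝ 2 τ (γ t₀) ∧ τ (γ t₀) = t₀ ∧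
      ∀ᶠ y in 𝓝 (γ t₀), inner ℝ (y - γ (τ y)) (deriv γ (τ y)) = 0 ∧
        ‖y - γ (τ y)‖ = infDist y (range γ) := by
  have hγ2 : ContDiff ℝ 2 γ := hγ.of_le (by norm_num)
  have hγ' : ContDiff ℝ 2 (deriv γ) := (contDiff_succ_iff_deriv.1 (by exact_mod_cast hγ)).2.2
  have hdiff : Differentiable ℝ γ := hγ.differentiable (by norm_num)
  set F : E × ℝ → ℝ := fun v => inner ℝ (v.1 - γ v.2) (deriv γ v.2) with hF
  have hFc : ContDiff ℝ 2 F := by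
    refine ContDiff.inner ℝ ?_ ?_ <;> fun_prop
  have hF0 : F (γ t₀, t₀) = 0 := by simp [hF]
  have hline : HasDerivAt (fun s => F (γ t₀, s)) (-‖deriv γ t₀‖ ^ 2) t₀ := by
    have h1 : HasDerivAt (fun s => γ t₀ - γ s) (-deriv γ t₀) t₀ :=
      (hdiff t₀).hasDerivAt.const_sub _
    have h2 := h1.inner ℝ ((hγ'.differentiable (by norm_num) t₀).hasDerivAt)
    refine h2.congr_deriv ?_
    simp [inner_neg_left]
  have hL : (fderiv ℝ F (γ t₀, t₀) ∘L .inr ℝ E ℝ) 1 = -‖deriv γ t₀‖ ^ 2 := by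
    have h1 : HasFDerivAt F (fderiv ℝ F (γ t₀, t₀)) (γ t₀, t₀) :=
      (hFc.differentiable (by norm_num) _).hasFDerivAt
    have h2 : HasDerivAt (fun s : ℝ => (γ t₀, s)) ((0 : E), (1 : ℝ)) t₀ :=
      (hasDerivAt_const t₀ (γ t₀)).prodMk (hasDerivAt_id t₀)
    exact (h1.comp_hasDerivAt t₀ h2).unique hline
  have hne : -‖deriv γ t₀‖ ^ 2 ≠ 0 := by
    simpa using hreg t₀
  have hinv : (fderiv ℝ F (γ t₀, t₀) ∘L .inr ℝ E ℝ).IsInvertible := by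
    refine ⟨ContinuousLinearEquiv.unitsEquivAut ℝ (Units.mk0 _ hne), ?_⟩
    ext
    rw [hL]
    simp
  have hcd : ContDiffAt ℝ 2 F (γ t₀, t₀) := hFc.contDiffAt
  set τ := hcd.implicitFunction two_ne_zero hinv with hτ
  have hτ0 : τ (γ t₀) = t₀ := hcd.implicitFunction_apply_self two_ne_zero hinv
  refine ⟨τ, hcd.contDiffAt_implicitFunction two_ne_zero hinv, hτ0, ?_⟩
  have huniq := hcd.eventually_apply_eq_iff_implicitFunction two_ne_zero hinv
  rw [hF0] at huniq
  obtain ⟨r, hr, hball⟩ := Metric.eventually_nhds_iff.1 huniq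
  obtain ⟨δ, hδ, hnear⟩ := exists_param_near_of_dist_lt hγ.continuous hper hinj t₀ hr
  have hmem : ball (γ t₀) (min r (δ / 2)) ∈ 𝓝 (γ t₀) := ball_mem_nhds _ (by positivity)
  filter_upwards [hmem] with y hy
  obtain ⟨hyr, hyδ⟩ := lt_min_iff.1 (mem_ball.1 hy)
  obtain ⟨s, hs⟩ := exists_infDist_range_eq_dist hγ.continuous hper y
  have h1 : dist y (γ s) ≤ dist y (γ t₀) := hs ▸ infDist_le_dist_of_mem (mem_range_self t₀)
  have h2 : dist (γ s) (γ t₀) < δ := by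
    have := dist_triangle_left (γ s) (γ t₀) y
    linarith
  obtain ⟨s', hs', hs'r⟩ := hnear s h2
  rw [← hs'] at hs
  have h3 : F (y, s') = 0 := inner_sub_deriv_eq_zero_of_infDist_eq (hdiff s') hs
  have h4 : τ y = s' :=
    (hball (y := (y, s')) (by rw [Prod.dist_eq]; exact max_lt hyr hs'r)).1 h3
  rw [h4]
  exact ⟨h3, by rw [hs, dist_eq_norm]⟩

theorem lap_congr_of_eventuallyEq {n : ℕ} {f g : EuclideanSpace ℝ (Fin n) → ℝ}
    {x : EuclideanSpace ℝ (Fin n)} (h : f =ᶠ[𝓝 x] g) : lap f x = lap g x := by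
  simp only [lap, iteratedFDeriv_two_apply, h.fderiv.fderiv_eq]

theorem exists_coisometry_of_norm_eq_one {n m : ℕ} (hmn : m + 1 = n)
    {a : EuclideanSpace ℝ (Fin n)} (ha : ‖a‖ = 1) :
    ∃ P : EuclideanSpace ℝ (Fin n) →L[ℝ] EuclideanSpace ℝ (Fin m), P a = 0 ∧
      (∀ v, inner ℝ a v = 0 → ‖P v‖ = ‖v‖) ∧
      ∀ B : EuclideanSpace ℝ (Fin m) →L[ℝ] EuclideanSpace ℝ (Fin m) →L[ℝ] ℝ,
        ∑ i, B (P (EuclideanSpace.single i 1)) (P (EuclideanSpace.single i 1)) =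
          ∑ j, B (EuclideanSpace.single j 1) (EuclideanSpace.single j 1) := by
  have ha0 : a ≠ 0 := by rintro rfl; simp at ha
  have : Fact (Module.finrank ℝ (EuclideanSpace ℝ (Fin n)) = m + 1) := ⟨by simp [hmn]⟩
  set S : Submodule ℝ (EuclideanSpace ℝ (Fin n)) := (ℝ ∙ a)ᗮ with hS
  let b : OrthonormalBasis (Fin m) ℝ S := (stdOrthonormalBasis ℝ S).reindex
    (finCongr (Submodule.finrank_orthogonal_span_singleton ha0))
  let P : EuclideanSpace ℝ (Fin n) →L[ℝ] EuclideanSpace ℝ (Fin m) :=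
    (b.repr.toContinuousLinearEquiv : S →L[ℝ] EuclideanSpace ℝ (Fin m)) ∘L S.orthogonalProjectionOnto
  have hPapp : ∀ v, P v = b.repr (S.orthogonalProjectionOnto v) := fun v => rfl
  have hPcoord : ∀ v j, P v j = inner ℝ (b j : EuclideanSpace ℝ (Fin n)) v := by
    intro v j
    rw [hPapp, b.repr_apply_apply, Submodule.inner_orthogonalProjectionOnto_eq_of_mem_left]
  refine ⟨P, ?_, ?_, ?_⟩
  · ext j
    rw [hPcoord]
    exact Submodule.mem_orthogonal_singleton_iff_inner_left.1 (b j).2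
  · intro v hv
    have hvS : v ∈ S := Submodule.mem_orthogonal_singleton_iff_inner_right.2 hv
    rw [hPapp, LinearIsometryEquiv.norm_map, 
      S.orthogonalProjectionOnto_mem_subspace_eq_self ⟨v, hvS⟩]
    rfl
  · intro B
    have hexp : ∀ v : EuclideanSpace ℝ (Fin m), B v v = ∑ j, ∑ k, v j * v k *
        B (EuclideanSpace.single j 1) (EuclideanSpace.single k 1) := by
      intro v
      conv_lhs => rw [← (EuclideanSpace.basisFun (Fin m) ℝ).sum_repr v]
      simp only [EuclideanSpace.basisFun_repr, EuclideanSpace.basisFun_apply, map_sum, map_smul,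
        sum_apply, smul_apply, smul_eq_mul, Finset.mul_sum]
      rw [Finset.sum_comm]
      exact Finset.sum_congr rfl fun j _ => Finset.sum_congr rfl fun k _ => by ring
    calc _ = ∑ i, ∑ j, ∑ k, P (EuclideanSpace.single i 1) j * P (EuclideanSpace.single i 1) k *
              B (EuclideanSpace.single j 1) (EuclideanSpace.single k 1) :=
            Finset.sum_congr rfl fun i _ => hexp _
      _ = ∑ j, ∑ k, (∑ i, P (EuclideanSpace.single i 1) j * P (EuclideanSpace.single i 1) k) *
              B (EuclideanSpace.single j 1) (EuclideanSpace.single k 1) := by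
            rw [Finset.sum_comm]
            refine Finset.sum_congr rfl fun j _ => ?_
            rw [Finset.sum_comm]
            exact Finset.sum_congr rfl fun k _ => (Finset.sum_mul _ _ _).symm
      _ = ∑ j, ∑ k, (if j = k then 1 else 0) *
              B (EuclideanSpace.single j 1) (EuclideanSpace.single k 1) := by
            refine Finset.sum_congr rfl fun j _ => Finset.sum_congr rfl fun k _ => ?_
            congr 1
            have h := (EuclideanSpace.basisFun (Fin n) ℝ).sum_inner_mul_inner
              (b j : EuclideanSpace ℝ (Fin n)) (b k : EuclideanSpace ℝ (Fin n))
            simp only [EuclideanSpace.basisFun_apply] at h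
            rw [← Submodule.coe_inner, orthonormal_iff_ite.1 b.orthonormal] at h
            rw [← h]
            refine Finset.sum_congr rfl fun i _ => ?_
            rw [hPcoord, hPcoord, real_inner_comm _ (b k : EuclideanSpace ℝ (Fin n))]
      _ = _ := by simp

theorem norm_sub_smul_add_eq {E : Type*} [NormedAddCommGroup E] [InnerProductSpace ℝ E]
    {a b w : E} (ha : ‖a‖ = 1) (hb : ‖b‖ = 1) (hw : inner ℝ w b = 0)
    (hab : 1 + inner ℝ a b ≠ 0) :
    inner ℝ a (w - (inner ℝ a w / (1 + inner ℝ a b)) • (a + b)) = 0 ∧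
      ‖w - (inner ℝ a w / (1 + inner ℝ a b)) • (a + b)‖ = ‖w‖ := by
  constructor
  · rw [inner_sub_right, inner_smul_right, inner_add_right, real_inner_self_eq_norm_sq, ha]
    field_simp
    ring
  · rw [← sq_eq_sq₀ (norm_nonneg _) (norm_nonneg _), norm_sub_sq_real, inner_smul_right,
      inner_add_right, hw, norm_smul, mul_pow, norm_add_sq_real, ha, hb, real_inner_comm,
      Real.norm_eq_abs, sq_abs]
    field_simp
    ring

theorem exists_normal_chart {n m : ℕ} (hmn : m + 1 = n) {γ : ℝ → EuclideanSpace ℝ (Fin n)}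
    (hγ : ContDiff ℝ 3 γ) (hreg : ∀ t : ℝ, deriv γ t ≠ 0) (t₀ : ℝ)
    {τ : EuclideanSpace ℝ (Fin n) → ℝ} (hτ : ContDiffAt ℝ 2 τ (γ t₀)) (hτ₀ : τ (γ t₀) = t₀)
    (hfoot : ∀ᶠ y in 𝓝 (γ t₀), inner ℝ (y - γ (τ y)) (deriv γ (τ y)) = 0 ∧
        ‖y - γ (τ y)‖ = infDist y (range γ)) :
    ∃ (Φ : EuclideanSpace ℝ (Fin n) → EuclideanSpace ℝ (Fin m)),
      ContDiffAt ℝ 2 Φ (γ t₀) ∧ (∀ᶠ y in 𝓝 (γ t₀), ‖Φ y‖ = infDist y (range γ)) ∧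
      ∀ B : EuclideanSpace ℝ (Fin m) →L[ℝ] EuclideanSpace ℝ (Fin m) →L[ℝ] ℝ,
        ∑ i, B (fderiv ℝ Φ (γ t₀) (EuclideanSpace.single i 1))
            (fderiv ℝ Φ (γ t₀) (EuclideanSpace.single i 1)) =
          ∑ j, B (EuclideanSpace.single j 1) (EuclideanSpace.single j 1) := by
  have hγ2 : ContDiff ℝ 2 γ := hγ.of_le (by norm_num)
  have hγ' : ContDiff ℝ 2 (deriv γ) := (contDiff_succ_iff_deriv.1 (by exact_mod_cast hγ)).2.2
  set T : ℝ → EuclideanSpace ℝ (Fin n) := fun t => ‖deriv γ t‖⁻¹ • deriv γ t with hT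
  have hTc : ContDiff ℝ 2 T :=
    ((hγ'.norm ℝ hreg).inv fun t => norm_ne_zero_iff.2 (hreg t)).smul hγ'
  have hT1 : ∀ t, ‖T t‖ = 1 := fun t => norm_smul_inv_norm (hreg t)
  have hγT : ∀ t, deriv γ t = ‖deriv γ t‖ • T t := fun t => by
    simp [hT, smul_smul, hreg t]
  obtain ⟨P, hPa, hPn, hPB⟩ := exists_coisometry_of_norm_eq_one hmn (hT1 t₀)
  set a := T t₀ with ha
  have haT : ContDiffAt ℝ 2 (fun y => T (τ y)) (γ t₀) := hTc.contDiffAt.comp _ hτ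
  have hw : ContDiffAt ℝ 2 (fun y => y - γ (τ y)) (γ t₀) :=
    contDiffAt_id.sub (hγ2.contDiffAt.comp _ hτ)
  have hden : ContDiffAt ℝ 2 (fun y => 1 + inner ℝ a (T (τ y))) (γ t₀) :=
    contDiffAt_const.add (contDiffAt_const.inner ℝ haT)
  have hden0 : 1 + inner ℝ a (T (τ (γ t₀))) ≠ 0 := by
    rw [hτ₀, real_inner_self_eq_norm_sq, hT1]; norm_num
  set c : EuclideanSpace ℝ (Fin n) → ℝ :=
    fun y => inner ℝ a (y - γ (τ y)) / (1 + inner ℝ a (T (τ y))) with hc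
  have hcc : ContDiffAt ℝ 2 c (γ t₀) := (contDiffAt_const.inner ℝ hw).div hden hden0
  have hc0 : c (γ t₀) = 0 := by simp [hc, hτ₀]
  set Φ : EuclideanSpace ℝ (Fin n) → EuclideanSpace ℝ (Fin m) :=
    fun y => P y - P (γ (τ y)) - c y • P (T (τ y)) with hΦ
  have hder : HasFDerivAt Φ P (γ t₀) := by
    have h1 : HasFDerivAt (fun y => γ (τ y))
        ((fderiv ℝ τ (γ t₀)).smulRight (deriv γ t₀)) (γ t₀) := by
      have h : HasFDerivAt γ (ContinuousLinearMap.toSpanSingleton ℝ (deriv γ t₀)) (τ (γ t₀)) := by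
        rw [hτ₀]
        exact (hγ2.differentiable (by norm_num) t₀).hasDerivAt.hasFDerivAt
      refine (h.comp (γ t₀) (hτ.differentiableAt (by norm_num)).hasFDerivAt).congr_fderiv ?_
      ext1 v
      simp
    have h2 := P.hasFDerivAt.comp (γ t₀) h1
    have h3 := (hcc.differentiableAt (by norm_num)).hasFDerivAt.smul
      (P.hasFDerivAt.comp (γ t₀) (haT.differentiableAt (by norm_num)).hasFDerivAt)
    refine ((P.hasFDerivAt.sub h2).sub h3).congr_fderiv ?_
    ext v : 1
    simp only [Function.comp_apply, hc0, hτ₀, ← ha, hPa]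
    rw [hγT t₀]
    simp [← ha, hPa]
  refine ⟨Φ, ?_, ?_, ?_⟩
  · exact (P.contDiff.contDiffAt.sub (P.contDiff.contDiffAt.comp _
      (hγ2.contDiffAt.comp _ hτ))).sub (hcc.smul (P.contDiff.contDiffAt.comp _ haT))
  · filter_upwards [hfoot, hden.continuousAt.eventually_ne hden0] with y ⟨hy1, hy2⟩ hy3
    have hwT : inner ℝ (y - γ (τ y)) (T (τ y)) = 0 := by
      simp only [hT, inner_smul_right, hy1, mul_zero]
    obtain ⟨h1, h2⟩ := norm_sub_smul_add_eq (hT1 t₀) (hT1 (τ y)) hwT hy3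
    rw [← hy2, ← h2, ← hPn _ h1]
    congr 1
    simp [hΦ, hc, ← ha, hPa]
  · rw [hder.fderiv]
    exact hPB

theorem lap_comp {n m : ℕ} {f : EuclideanSpace ℝ (Fin m) → ℝ}
    {g : EuclideanSpace ℝ (Fin n) → EuclideanSpace ℝ (Fin m)} {x : EuclideanSpace ℝ (Fin n)}
    (hf : ContDiffAt ℝ 2 f (g x)) (hg : ContDiffAt ℝ 2 g x) :
    lap (fun y => f (g y)) x = ∑ i,
      (fderiv ℝ (fderiv ℝ f) (g x) (fderiv ℝ g x (EuclideanSpace.single i 1))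
          (fderiv ℝ g x (EuclideanSpace.single i 1)) +
        fderiv ℝ f (g x) (fderiv ℝ (fderiv ℝ g) x (EuclideanSpace.single i 1)
          (EuclideanSpace.single i 1))) := by
  have h1 : fderiv ℝ (fun y => f (g y)) =ᶠ[𝓝 x] fun y => (fderiv ℝ f (g y)) ∘L fderiv ℝ g y := by
    filter_upwards [hg.eventually (by simp), hg.continuousAt.eventually (hf.eventually (by simp))]
      with y hy1 hy2
    exact fderiv_comp y (hy2.differentiableAt (by norm_num)) (hy1.differentiableAt (by norm_num))
  have hf' : HasFDerivAt (fderiv ℝ f) (fderiv ℝ (fderiv ℝ f) (g x)) (g x) :=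
    ((hf.fderiv_right (m := 1) (by norm_num)).differentiableAt (by norm_num)).hasFDerivAt
  have hg' : HasFDerivAt (fderiv ℝ g) (fderiv ℝ (fderiv ℝ g) x) x :=
    ((hg.fderiv_right (m := 1) (by norm_num)).differentiableAt (by norm_num)).hasFDerivAt
  have h2 := (hf'.comp x (hg.differentiableAt (by norm_num)).hasFDerivAt).clm_comp hg'
  have h3 := (h2.congr_of_eventuallyEq h1).fderiv
  refine Finset.sum_congr rfl fun i _ => ?_
  rw [iteratedFDeriv_two_apply, h3]
  simp [add_comm]

theorem sq_mul_lap_comp_inv_smul {n m : ℕ} {f : EuclideanSpace ℝ (Fin m) → ℝ}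
    {g : EuclideanSpace ℝ (Fin n) → EuclideanSpace ℝ (Fin m)} {x : EuclideanSpace ℝ (Fin n)}
    {ε : ℝ} (hε : ε ≠ 0)
    (hf : ContDiffAt ℝ 2 f (ε⁻¹ • g x)) (hg : ContDiffAt ℝ 2 g x) :
    ε ^ 2 * lap (fun y => f (ε⁻¹ • g y)) x = ∑ i,
      (fderiv ℝ (fderiv ℝ f) (ε⁻¹ • g x) (fderiv ℝ g x (EuclideanSpace.single i 1))
          (fderiv ℝ g x (EuclideanSpace.single i 1)) +
        ε * fderiv ℝ f (ε⁻¹ • g x) (fderiv ℝ (fderiv ℝ g) x (EuclideanSpace.single i 1)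
          (EuclideanSpace.single i 1))) := by
  have h1 : fderiv ℝ (fun y => ε⁻¹ • g y) = fun y => ε⁻¹ • fderiv ℝ g y := by
    ext1 y
    exact congrFun (fderiv_const_smul_field (𝕜 := ℝ) (f := g) ε⁻¹) y
  have h2 : fderiv ℝ (fun y => ε⁻¹ • fderiv ℝ g y) x = ε⁻¹ • fderiv ℝ (fderiv ℝ g) x :=
    congrFun (fderiv_const_smul_field (𝕜 := ℝ) (f := fderiv ℝ g) ε⁻¹) x
  rw [lap_comp (g := fun y => ε⁻¹ • g y) hf (hg.const_smul ε⁻¹), h1, h2, Finset.mul_sum]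
  refine Finset.sum_congr rfl fun i _ => ?_
  simp only [smul_apply, map_smul, smul_eq_mul]
  field_simp

theorem exists_bound_fderiv_of_contDiffOn_closedBall {m : ℕ} {f : EuclideanSpace ℝ (Fin m) → ℝ}
    (hf : ContDiffOn ℝ 2 f (closedBall 0 1)) :
    ∃ M, 0 ≤ M ∧ ∀ z ∈ ball (0 : EuclideanSpace ℝ (Fin m)) 1,
      ‖fderiv ℝ f z‖ ≤ M ∧ ‖fderiv ℝ (fderiv ℝ f) z‖ ≤ M := by
  have hu : UniqueDiffOn ℝ (closedBall (0 : EuclideanSpace ℝ (Fin m)) 1) := by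
    refine uniqueDiffOn_convex (convex_closedBall _ _) ⟨0, ?_⟩
    exact ball_subset_interior_closedBall (mem_ball_self one_pos)
  have hb : ∀ k : ℕ, k ≤ 2 → ∃ C, ∀ z ∈ ball (0 : EuclideanSpace ℝ (Fin m)) 1,
      ‖iteratedFDeriv ℝ k f z‖ ≤ C := by
    intro k hk
    obtain ⟨C, hC⟩ := (isCompact_closedBall (0 : EuclideanSpace ℝ (Fin m)) 1).exists_bound_of_continuousOn
      (hf.continuousOn_iteratedFDerivWithin (m := k) (by exact_mod_cast hk) hu)
    refine ⟨C, fun z hz => ?_⟩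
    have hcd : ContDiffAt ℝ 2 f z :=
      hf.contDiffAt (mem_of_superset (isOpen_ball.mem_nhds hz) ball_subset_closedBall)
    rw [← iteratedFDerivWithin_eq_iteratedFDeriv hu (hcd.of_le (by exact_mod_cast hk))
      (ball_subset_closedBall hz)]
    exact hC z (ball_subset_closedBall hz)
  obtain ⟨C₁, hC₁⟩ := hb 1 (by norm_num)
  obtain ⟨C₂, hC₂⟩ := hb 2 le_rfl
  refine ⟨max 0 (max C₁ C₂), le_max_left _ _, fun z hz => ⟨?_, ?_⟩⟩
  · rw [← norm_iteratedFDeriv_one]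
    exact (hC₁ z hz).trans ((le_max_left _ _).trans (le_max_right _ _))
  · rw [← norm_iteratedFDeriv_one, norm_iteratedFDeriv_fderiv]
    exact (hC₂ z hz).trans ((le_max_right _ _).trans (le_max_right _ _))

theorem abs_apply_apply_sub_le {E F : Type*} [NormedAddCommGroup E] [NormedSpace ℝ E]
    [NormedAddCommGroup F] [NormedSpace ℝ F] (B : F →L[ℝ] F →L[ℝ] ℝ) (A P : E →L[ℝ] F) {e : E}
    (he : ‖e‖ ≤ 1) :
    |B (A e) (A e) - B (P e) (P e)| ≤ ‖B‖ * (‖A - P‖ * (‖A‖ + ‖P‖)) := by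
  have h1 : B (A e) (A e) - B (P e) (P e) = B ((A - P) e) (A e) + B (P e) ((A - P) e) := by
    simp
  have hle : ∀ L : E →L[ℝ] F, ‖L e‖ ≤ ‖L‖ := fun L => L.unit_le_opNorm e he
  rw [h1]
  calc _ ≤ |B ((A - P) e) (A e)| + |B (P e) ((A - P) e)| := abs_add_le _ _
    _ ≤ ‖B‖ * ‖A - P‖ * ‖A‖ + ‖B‖ * ‖P‖ * ‖A - P‖ :=
        add_le_add (B.le_of_opNorm₂_le_of_le le_rfl (hle _) (hle _))
          (B.le_of_opNorm₂_le_of_le le_rfl (hle _) (hle _))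
    _ = _ := by ring

theorem eventually_sq_mul_lap_comp_le {n m : ℕ} {f : EuclideanSpace ℝ (Fin m) → ℝ}
    (hf : ContDiffOn ℝ 2 f (closedBall 0 1))
    {Φ : EuclideanSpace ℝ (Fin n) → EuclideanSpace ℝ (Fin m)} {p : EuclideanSpace ℝ (Fin n)}
    (hΦ : ContDiffAt ℝ 2 Φ p)
    (htr : ∀ B : EuclideanSpace ℝ (Fin m) →L[ℝ] EuclideanSpace ℝ (Fin m) →L[ℝ] ℝ,
        ∑ i, B (fderiv ℝ Φ p (EuclideanSpace.single i 1))
            (fderiv ℝ Φ p (EuclideanSpace.single i 1)) =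
          ∑ j, B (EuclideanSpace.single j 1) (EuclideanSpace.single j 1))
    {η : ℝ} (hη : 0 < η) :
    ∃ ε₀ > 0, ∀ᶠ x in 𝓝 p, ∀ ε, 0 < ε → ε < ε₀ → ‖Φ x‖ < ε →
      ε ^ 2 * lap (fun y => f (ε⁻¹ • Φ y)) x ≤ lap f (ε⁻¹ • Φ x) + η := by
  obtain ⟨M, hM0, hM⟩ := exists_bound_fderiv_of_contDiffOn_closedBall hf
  set P := fderiv ℝ Φ p with hP
  have hΦ' : ContDiffAt ℝ 1 (fderiv ℝ Φ) p := hΦ.fderiv_right (by norm_num)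
  have hΦ'' : ContinuousAt (fderiv ℝ (fderiv ℝ Φ)) p :=
    (hΦ'.fderiv_right (m := 0) (by norm_num)).continuousAt
  set K := ‖fderiv ℝ (fderiv ℝ Φ) p‖ + 1 with hK
  have hKpos : 0 < K := by positivity
  have hev1 : ∀ᶠ x in 𝓝 p, ‖fderiv ℝ (fderiv ℝ Φ) x‖ < K := by
    have hc : ContinuousAt (fun x => ‖fderiv ℝ (fderiv ℝ Φ) x‖) p :=
      ContinuousAt.norm (E := EuclideanSpace ℝ (Fin n) →L[ℝ] EuclideanSpace ℝ (Fin n) →L[ℝ]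
        EuclideanSpace ℝ (Fin m)) hΦ''
    exact hc.eventually_lt_const (lt_add_one _)
  have hev2 : ∀ᶠ x in 𝓝 p,
      n * (M * (‖fderiv ℝ Φ x - P‖ * (‖fderiv ℝ Φ x‖ + ‖P‖))) < η / 2 := by
    have hc : ContinuousAt
        (fun x => n * (M * (‖fderiv ℝ Φ x - P‖ * (‖fderiv ℝ Φ x‖ + ‖P‖)))) p := by
      have := hΦ'.continuousAt
      fun_prop
    refine hc.eventually_lt_const ?_
    simpa [hP] using hη
  refine ⟨η / (2 * (n * (M * K) + 1)), by positivity, ?_⟩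
  filter_upwards [hev1, hev2, hΦ.eventually (by simp)] with x hx1 hx2 hx3 ε hε hε₀ hxε
  have hz : ε⁻¹ • Φ x ∈ ball (0 : EuclideanSpace ℝ (Fin m)) 1 := by
    rw [mem_ball_zero_iff, norm_smul, norm_inv, Real.norm_of_nonneg hε.le, inv_mul_lt_one₀ hε]
    exact hxε
  have hfz : ContDiffAt ℝ 2 f (ε⁻¹ • Φ x) :=
    hf.contDiffAt (mem_of_superset (isOpen_ball.mem_nhds hz) ball_subset_closedBall)
  obtain ⟨hM1, hM2⟩ := hM _ hz
  set z := ε⁻¹ • Φ x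
  have hlap : lap f z = ∑ i, fderiv ℝ (fderiv ℝ f) z (P (EuclideanSpace.single i 1))
      (P (EuclideanSpace.single i 1)) := by
    rw [htr, lap]
    simp [iteratedFDeriv_two_apply]
  have hterm : ∀ i : Fin n,
      fderiv ℝ (fderiv ℝ f) z (fderiv ℝ Φ x (EuclideanSpace.single i 1))
          (fderiv ℝ Φ x (EuclideanSpace.single i 1)) +
        ε * fderiv ℝ f z (fderiv ℝ (fderiv ℝ Φ) x (EuclideanSpace.single i 1)
          (EuclideanSpace.single i 1)) ≤
      fderiv ℝ (fderiv ℝ f) z (P (EuclideanSpace.single i 1)) (P (EuclideanSpace.single i 1)) +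
        (M * (‖fderiv ℝ Φ x - P‖ * (‖fderiv ℝ Φ x‖ + ‖P‖)) + ε * (M * K)) := by
    intro i
    have he : ‖(EuclideanSpace.single i 1 : EuclideanSpace ℝ (Fin n))‖ ≤ 1 := by simp
    have h1 := (le_abs_self _).trans
      (abs_apply_apply_sub_le (fderiv ℝ (fderiv ℝ f) z) (fderiv ℝ Φ x) P he)
    have h2 : ‖fderiv ℝ (fderiv ℝ f) z‖ * (‖fderiv ℝ Φ x - P‖ * (‖fderiv ℝ Φ x‖ + ‖P‖)) ≤
        M * (‖fderiv ℝ Φ x - P‖ * (‖fderiv ℝ Φ x‖ + ‖P‖)) := by gcongr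
    have h3 : ‖fderiv ℝ (fderiv ℝ Φ) x (EuclideanSpace.single i 1)
        (EuclideanSpace.single i 1)‖ ≤ K := by
      have := (fderiv ℝ (fderiv ℝ Φ) x).le_of_opNorm₂_le_of_le hx1.le he he
      simpa using this
    have h4 : fderiv ℝ f z (fderiv ℝ (fderiv ℝ Φ) x (EuclideanSpace.single i 1)
        (EuclideanSpace.single i 1)) ≤ M * K :=
      (le_abs_self _).trans ((fderiv ℝ f z).le_of_opNorm_le_of_le hM1 h3)
    have h5 := mul_le_mul_of_nonneg_left h4 hε.le
    linarith
  rw [sq_mul_lap_comp_inv_smul hε.ne' hfz hx3]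
  refine (Finset.sum_le_sum fun i _ => hterm i).trans ?_
  rw [Finset.sum_add_distrib, ← hlap, Finset.sum_const, Finset.card_univ, Fintype.card_fin,
    nsmul_eq_mul]
  have h6 : ε * (2 * (n * (M * K) + 1)) < η := (lt_div_iff₀ (by positivity)).1 hε₀
  nlinarith

/-- With `u_ε(x) = U(dist(x,Λ)/ε)` and `w_ε(x) = W(dist(x,Λ)/ε)`, for all
sufficiently small `ε > 0` one has `ε² Δw_ε + λ e^{u_ε} w_ε ≤ −1/2` on `T_ε(Λ)`. -/
theorem tube_supersolution_estimate
    (n : ℕ) (hn : 3 ≤ n)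
    -- `Λ = range γ` is a smooth closed curve embedded in `ℝⁿ`
    (γ : ℝ → EuclideanSpace ℝ (Fin n)) (hγ_smooth : ContDiff ℝ (⊤ : ℕ∞) γ)
    (hγ_per : Function.Periodic γ 1)
    (hγ_reg : ∀ t : ℝ, deriv γ t ≠ 0)
    (hγ_inj : ∀ s t : ℝ, γ s = γ t → ∃ k : ℤ, s - t = (k : ℝ))
    (Λ : Set (EuclideanSpace ℝ (Fin n))) (hΛ : Λ = Set.range γ)
    (lam : ℝ) (hlam : 0 < lam)
    -- `U` is a radial stable solution of the Gelfand problem in `B^{n-1}`, of profile `U₀`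
    (U : EuclideanSpace ℝ (Fin (n - 1)) → ℝ) (U₀ : ℝ → ℝ)
    (hUrad : ∀ z : EuclideanSpace ℝ (Fin (n - 1)), U z = U₀ ‖z‖)
    (hUC2 : ContDiffOn ℝ 2 U (closedBall (0 : EuclideanSpace ℝ (Fin (n - 1))) 1))
    (hUsol : ∀ z ∈ ball (0 : EuclideanSpace ℝ (Fin (n - 1))) 1, lap U z + lam * exp (U z) = 0)
    (hUbdry : ∀ z ∈ sphere (0 : EuclideanSpace ℝ (Fin (n - 1))) 1, U z = 0)
    (hUstab : ∀ φ : EuclideanSpace ℝ (Fin (n - 1)) → ℝ, ContDiff ℝ 1 φ → HasCompactSupport φ →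
      tsupport φ ⊆ ball (0 : EuclideanSpace ℝ (Fin (n - 1))) 1 →
      lam * ∫ z in ball (0 : EuclideanSpace ℝ (Fin (n - 1))) 1, exp (U z) * φ z ^ 2 ≤
        ∫ z in ball (0 : EuclideanSpace ℝ (Fin (n - 1))) 1, ‖gradient φ z‖ ^ 2)
    -- `W` is the radial solution of `−ΔW − λ e^U W = 1` in `B^{n-1}`, of profile `W₀`
    (W : EuclideanSpace ℝ (Fin (n - 1)) → ℝ) (W₀ : ℝ → ℝ)
    (hWrad : ∀ z : EuclideanSpace ℝ (Fin (n - 1)), W z = W₀ ‖z‖)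
    (hWC2 : ContDiffOn ℝ 2 W (closedBall (0 : EuclideanSpace ℝ (Fin (n - 1))) 1))
    (hWsol : ∀ z ∈ ball (0 : EuclideanSpace ℝ (Fin (n - 1))) 1,
      -(lap W z) - lam * exp (U z) * W z = 1)
    (hWbdry : ∀ z ∈ sphere (0 : EuclideanSpace ℝ (Fin (n - 1))) 1, W z = 0) :
    ∃ ε₀ > (0 : ℝ), ∀ ε : ℝ, 0 < ε → ε < ε₀ →
      ∀ x ∈ tube Λ ε,
        ε ^ 2 * lap (fun y => W₀ (Metric.infDist y Λ / ε)) x +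
            lam * exp (U₀ (Metric.infDist x Λ / ε)) * W₀ (Metric.infDist x Λ / ε) ≤
          -(1 / 2) := by
  subst hΛ
  have hγ3 : ContDiff ℝ 3 γ := contDiff_infty.1 hγ_smooth 3
  have hcpt : IsCompact (range γ) := by
    rw [← hγ_per.image_Icc one_pos 0]
    exact isCompact_Icc.image hγ_smooth.continuous
  have hloc : ∀ p ∈ range γ, ∃ ε₀ > (0 : ℝ), ∀ᶠ x in 𝓝 p, ∀ ε, 0 < ε → ε < ε₀ →
      infDist x (range γ) < ε →
        ε ^ 2 * lap (fun y => W₀ (infDist y (range γ) / ε)) x +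
            lam * exp (U₀ (infDist x (range γ) / ε)) * W₀ (infDist x (range γ) / ε) ≤
          -(1 / 2) := by
    rintro _ ⟨t₀, rfl⟩
    obtain ⟨τ, hτ, hτ₀, hfoot⟩ := exists_contDiffAt_footpoint hγ3 hγ_per hγ_reg hγ_inj t₀
    obtain ⟨Φ, hΦ, hΦn, htr⟩ :=
      exists_normal_chart (m := n - 1) (by omega) hγ3 hγ_reg t₀ hτ hτ₀ hfoot
    obtain ⟨ε₀, hε₀, hev⟩ := eventually_sq_mul_lap_comp_le hWC2 hΦ htr (η := 1 / 2) (by norm_num)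
    refine ⟨ε₀, hε₀, ?_⟩
    filter_upwards [hev, hΦn.eventually_nhds] with x hx hxn ε hε hεε₀ hxε
    have hnorm : ∀ y, ‖Φ y‖ = infDist y (range γ) →
        ‖ε⁻¹ • Φ y‖ = infDist y (range γ) / ε := fun y hy => by
      rw [norm_smul, norm_inv, Real.norm_of_nonneg hε.le, hy, div_eq_inv_mul]
    have hWeq : (fun y => W₀ (infDist y (range γ) / ε)) =ᶠ[𝓝 x] fun y => W (ε⁻¹ • Φ y) := by
      filter_upwards [hxn] with y hy
      rw [hWrad, hnorm y hy]
    have hxx := hxn.self_of_nhds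
    have hz : ε⁻¹ • Φ x ∈ ball (0 : EuclideanSpace ℝ (Fin (n - 1))) 1 := by
      rw [mem_ball_zero_iff, hnorm x hxx, div_lt_one hε]
      exact hxε
    have hmain := hx ε hε hεε₀ (hxx.trans_lt hxε)
    have hsol := hWsol _ hz
    rw [lap_congr_of_eventuallyEq hWeq, ← hnorm x hxx, ← hUrad, ← hWrad]
    linarith
  obtain ⟨ε₁, hε₁, V, hV, hVε⟩ : ∃ ε₁ > (0 : ℝ), ∃ V ∈ 𝓝ˢ (range γ), ∀ x ∈ V, ∀ ε, 0 < ε →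
      ε < ε₁ → infDist x (range γ) < ε →
        ε ^ 2 * lap (fun y => W₀ (infDist y (range γ) / ε)) x +
            lam * exp (U₀ (infDist x (range γ) / ε)) * W₀ (infDist x (range γ) / ε) ≤
          -(1 / 2) := by
    refine hcpt.induction_on (p := fun S => ∃ ε₁ > (0 : ℝ), ∃ V ∈ 𝓝ˢ S, ∀ x ∈ V, ∀ ε, 0 < ε →
      ε < ε₁ → infDist x (range γ) < ε →
        ε ^ 2 * lap (fun y => W₀ (infDist y (range γ) / ε)) x +
            lam * exp (U₀ (infDist x (range γ) / ε)) * W₀ (infDist x (range γ) / ε) ≤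
          -(1 / 2)) ?_ ?_ ?_ ?_
    · exact ⟨1, one_pos, ∅, by simp, by simp⟩
    · rintro S S' hSS' ⟨ε₁, hε₁, V, hV, h⟩
      exact ⟨ε₁, hε₁, V, nhdsSet_mono hSS' hV, h⟩
    · rintro S S' ⟨ε₁, hε₁, V, hV, h⟩ ⟨ε₂, hε₂, V', hV', h'⟩
      refine ⟨min ε₁ ε₂, lt_min hε₁ hε₂, V ∪ V', union_mem_nhdsSet hV hV', ?_⟩
      rintro x (hx | hx) ε hε hlt
      · exact h x hx ε hε (hlt.trans_le (min_le_left _ _))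
      · exact h' x hx ε hε (hlt.trans_le (min_le_right _ _))
    · intro p hp
      obtain ⟨ε₀, hε₀, hev⟩ := hloc p hp
      obtain ⟨V, hV, hVo, hpV⟩ := _root_.eventually_nhds_iff.1 hev
      exact ⟨V, mem_nhdsWithin_of_mem_nhds (hVo.mem_nhds hpV), ε₀, hε₀, V,
        hVo.mem_nhdsSet_self, hV⟩
  obtain ⟨O, hO, hΛO, hOV⟩ := mem_nhdsSet_iff_exists.1 hV
  obtain ⟨δ, hδ, hδO⟩ := hcpt.exists_thickening_subset_open hO hΛO
  refine ⟨min ε₁ δ, lt_min hε₁ hδ, fun ε hε hlt x hx => ?_⟩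
  refine hVε x (hOV (hδO ?_)) ε hε (hlt.trans_le (min_le_left _ _)) hx
  obtain ⟨s, hs⟩ := exists_infDist_range_eq_dist hγ_smooth.continuous hγ_per x
  have hxε : infDist x (range γ) < ε := hx
  exact mem_thickening_iff.2 ⟨γ s, mem_range_self s,
    hs ▸ hxε.trans (hlt.trans_le (min_le_right _ _))⟩
end
end

section
/- In the setting of the tube T_ε(Λ), with u_ε(x) = U(dist(x,Λ)/ε) and w_ε(x) = W(dist(x,Λ)/ε), set B := max(1, 2·‖λe^U W‖_{L^∞(B^{n−1})}). Suppose v ∈ C²(closure of T_ε(Λ)) satisfies Δ(u_ε + v) + (λ/ε²)e^{u_ε+v} = 0 in T_ε(Λ) with v = 0 on ∂T_ε(Λ), and |v| ≤ 1/B on T_ε(Λ). Then for all sufficiently small ε there is a constant C, independent of ε, with |v(x)| ≤ C·ε·w_ε(x) for all x ∈ T_ε(Λ). -/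
open Real MeasureTheory Metric Set Filter

noncomputable section

open scoped Topology RealInnerProductSpace

section SecondDerivative

variable {E : Type*} [NormedAddCommGroup E] [NormedSpace ℝ E]

/-- `A` is the second derivative of `f` at `x`. -/
def HasHessAt (f : E → ℝ) (A : E →L[ℝ] E →L[ℝ] ℝ) (x : E) : Prop :=
  ∃ f' : E → E →L[ℝ] ℝ, (∀ᶠ y in 𝓝 x, HasFDerivAt f (f' y) y) ∧ HasFDerivAt f' A x

lemma HasHessAt.add {f g : E → ℝ} {A B : E →L[ℝ] E →L[ℝ] ℝ} {x : E}
    (hf : HasHessAt f A x) (hg : HasHessAt g B x) : HasHessAt (fun y => f y + g y) (A + B) x := by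
  obtain ⟨f', hf1, hf2⟩ := hf
  obtain ⟨g', hg1, hg2⟩ := hg
  refine ⟨fun y => f' y + g' y, ?_, hf2.add hg2⟩
  filter_upwards [hf1, hg1] with y h1 h2 using h1.add h2

lemma HasHessAt.const_mul {f : E → ℝ} {A : E →L[ℝ] E →L[ℝ] ℝ} {x : E}
    (hf : HasHessAt f A x) (c : ℝ) : HasHessAt (fun y => c * f y) (c • A) x := by
  obtain ⟨f', hf1, hf2⟩ := hf
  refine ⟨fun y => c • f' y, ?_, hf2.const_smul c⟩
  filter_upwards [hf1] with y h1 using h1.const_mul c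

lemma ContDiffAt.hasHessAt {f : E → ℝ} {x : E} (hf : ContDiffAt ℝ 2 f x) :
    HasHessAt f (fderiv ℝ (fderiv ℝ f) x) x := by
  refine ⟨fderiv ℝ f, ?_, ?_⟩
  · filter_upwards [hf.eventually (by simp)] with y hy
    exact (hy.differentiableAt (by simp)).hasFDerivAt
  · exact ((hf.fderiv_right (m := 1) (by norm_num)).differentiableAt (by simp)).hasFDerivAt

/-- The second derivative is nonpositive on the diagonal at a local maximum. -/
lemma HasHessAt.nonpos_of_isLocalMax {f : E → ℝ} {A : E →L[ℝ] E →L[ℝ] ℝ} {x : E}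
    (hf : HasHessAt f A x) (hmax : IsLocalMax f x) (h : E) : A h h ≤ 0 := by
  obtain ⟨f', hf1, hf2⟩ := hf
  by_contra! hpos
  set l : ℝ → E := fun t => x + t • h with hl
  have hl0 : l 0 = x := by simp [hl]
  have hld : ∀ t, HasDerivAt l h t := fun t => by
    simpa [hl] using ((hasDerivAt_id t).smul_const h).const_add x
  have hlc : Tendsto l (𝓝 0) (𝓝 x) := by
    have := (hld 0).continuousAt.tendsto; rwa [hl0] at this
  have hg1 : ∀ᶠ t in 𝓝 (0 : ℝ), HasDerivAt (fun t => f (l t)) (f' (l t) h) t := by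
    filter_upwards [hlc.eventually hf1] with t ht
    exact ht.comp_hasDerivAt t (hld t)
  have hg1' : deriv (fun t => f (l t)) =ᶠ[𝓝 0] fun t => f' (l t) h := by
    filter_upwards [hg1] with t ht using ht.deriv
  have hg2 : HasDerivAt (fun t => f' (l t) h) (A h h) 0 := by
    have h1 : HasFDerivAt f' A (l 0) := by rwa [hl0]
    have := (h1.comp_hasDerivAt 0 (hld 0)).clm_apply (hasDerivAt_const 0 h)
    simpa using this
  have hmax' : IsLocalMax (fun t => f (l t)) 0 := by
    have : IsLocalMax f (l 0) := by rwa [hl0]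
    exact hlc.eventually (by rwa [hl0] at this) |>.mono fun t ht => by simpa [hl0] using ht
  have hmin : IsLocalMin (fun t => f (l t)) 0 := by
    refine isLocalMin_of_deriv_deriv_pos ?_ hmax'.deriv_eq_zero hg1.self_of_nhds.continuousAt
    rw [hg1'.deriv_eq, hg2.deriv]
    exact hpos
  have hconst : (fun t => f (l t)) =ᶠ[𝓝 0] fun _ => f (l 0) := by
    filter_upwards [hmax', hmin] with t h1 h2 using le_antisymm h1 h2
  have h3 : deriv (fun t => f (l t)) =ᶠ[𝓝 0] fun _ => 0 := by
    filter_upwards [hconst.eventuallyEq_nhds] with t ht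
    rw [ht.deriv_eq, deriv_const]
  have h4 := (hg1'.symm.trans h3).deriv_eq
  rw [hg2.deriv, deriv_const] at h4
  exact hpos.ne' h4

end SecondDerivative

lemma HasHessAt.lap_eq {n : ℕ} {f : EuclideanSpace ℝ (Fin n) → ℝ}
    {A : EuclideanSpace ℝ (Fin n) →L[ℝ] EuclideanSpace ℝ (Fin n) →L[ℝ] ℝ}
    {x : EuclideanSpace ℝ (Fin n)} (hf : HasHessAt f A x) :
    lap f x = ∑ i, A (EuclideanSpace.single i 1) (EuclideanSpace.single i 1) := by
  obtain ⟨f', hf1, hf2⟩ := hf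
  have h1 : fderiv ℝ f =ᶠ[𝓝 x] f' := by
    filter_upwards [hf1] with y hy using hy.fderiv
  unfold lap
  refine Finset.sum_congr rfl fun i _ => ?_
  rw [iteratedFDeriv_two_apply, h1.fderiv_eq, hf2.fderiv]
  simp

lemma HasHessAt.lap_nonpos_of_isLocalMax {n : ℕ} {f : EuclideanSpace ℝ (Fin n) → ℝ}
    {A : EuclideanSpace ℝ (Fin n) →L[ℝ] EuclideanSpace ℝ (Fin n) →L[ℝ] ℝ}
    {x : EuclideanSpace ℝ (Fin n)} (hf : HasHessAt f A x) (hmax : IsLocalMax f x) :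
    lap f x ≤ 0 := by
  rw [hf.lap_eq]
  exact Finset.sum_nonpos fun i _ => hf.nonpos_of_isLocalMax hmax _

/-- `f` has a second derivative at `x` with Laplacian `c`. -/
def HasLapAt {n : ℕ} (f : EuclideanSpace ℝ (Fin n) → ℝ) (c : ℝ)
    (x : EuclideanSpace ℝ (Fin n)) : Prop :=
  (∃ A, HasHessAt f A x) ∧ lap f x = c

section Lap

variable {n : ℕ} {f g : EuclideanSpace ℝ (Fin n) → ℝ} {a b : ℝ} {x : EuclideanSpace ℝ (Fin n)}

lemma HasLapAt.add (hf : HasLapAt f a x) (hg : HasLapAt g b x) :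
    HasLapAt (fun y => f y + g y) (a + b) x := by
  obtain ⟨⟨A, hA⟩, rfl⟩ := hf
  obtain ⟨⟨B, hB⟩, rfl⟩ := hg
  refine ⟨⟨_, hA.add hB⟩, ?_⟩
  rw [(hA.add hB).lap_eq, hA.lap_eq, hB.lap_eq, ← Finset.sum_add_distrib]
  simp

lemma HasLapAt.const_mul (hf : HasLapAt f a x) (c : ℝ) :
    HasLapAt (fun y => c * f y) (c * a) x := by
  obtain ⟨⟨A, hA⟩, rfl⟩ := hf
  refine ⟨⟨_, hA.const_mul c⟩, ?_⟩
  rw [(hA.const_mul c).lap_eq, hA.lap_eq, Finset.mul_sum]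
  simp

lemma ContDiffAt.hasLapAt (hf : ContDiffAt ℝ 2 f x) : HasLapAt f (lap f x) x :=
  ⟨⟨_, hf.hasHessAt⟩, rfl⟩

lemma HasLapAt.nonpos_of_isLocalMax (hf : HasLapAt f a x) (hmax : IsLocalMax f x) : a ≤ 0 := by
  obtain ⟨⟨A, hA⟩, rfl⟩ := hf
  exact hA.lap_nonpos_of_isLocalMax hmax

end Lap

/-- `p` is an even function on `(-1, 1)` with first and second derivatives `p₁`, `p₂`, the second
one bounded by `C`. -/
structure IsRadialProfile (p p₁ p₂ : ℝ → ℝ) (C : ℝ) : Prop where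
  even : ∀ r, p (-r) = p r
  deriv₁ : ∀ r ∈ Ioo (-1 : ℝ) 1, HasDerivAt p (p₁ r) r
  deriv₂ : ∀ r ∈ Ioo (-1 : ℝ) 1, HasDerivAt p₁ (p₂ r) r
  bound : ∀ r ∈ Ioo (-1 : ℝ) 1, |p₂ r| ≤ C

/-- The quotient `p'(r) / r`, extended by `p''(0)` at the origin. -/
def radialSlope (p₁ p₂ : ℝ → ℝ) (r : ℝ) : ℝ := if r = 0 then p₂ 0 else p₁ r / r

namespace IsRadialProfile

variable {p p₁ p₂ : ℝ → ℝ} {C : ℝ}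

lemma deriv_zero (h : IsRadialProfile p p₁ p₂ C) : p₁ 0 = 0 := by
  have h0 := h.deriv₁ 0 (by simp)
  have h1 : HasDerivAt (fun r => p (-r)) (-p₁ 0) 0 := by
    have h0' : HasDerivAt p (p₁ 0) (-0) := by simpa using h0
    simpa [Function.comp_def] using h0'.comp (0 : ℝ) (hasDerivAt_neg 0)
  simp only [h.even] at h1
  linarith [h0.unique h1]

lemma radialSlope_mul (h : IsRadialProfile p p₁ p₂ C) (r : ℝ) :
    radialSlope p₁ p₂ r * r = p₁ r := by
  unfold radialSlope
  split_ifs with h0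
  · simp [h0, h.deriv_zero]
  · field_simp

lemma abs_radialSlope_le (h : IsRadialProfile p p₁ p₂ C) {r : ℝ} (hr : r ∈ Ioo (-1 : ℝ) 1) :
    |radialSlope p₁ p₂ r| ≤ C := by
  unfold radialSlope
  split_ifs with h0
  · exact h.bound 0 (by simp)
  · have := (convex_Ioo (-1 : ℝ) 1).norm_image_sub_le_of_norm_hasDerivWithin_le
      (fun x hx => (h.deriv₂ x hx).hasDerivWithinAt) (fun x hx => h.bound x hx)
      (x := 0) (by simp) hr
    rw [h.deriv_zero, sub_zero, sub_zero, Real.norm_eq_abs, Real.norm_eq_abs] at this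
    rw [abs_div, div_le_iff₀ (abs_pos.2 h0)]
    exact this

variable {E : Type*} [NormedAddCommGroup E] [InnerProductSpace ℝ E]

lemma hasFDerivAt_norm_of_ne_zero {z : E} (hz : z ≠ 0) :
    HasFDerivAt (fun y : E => ‖y‖) (‖z‖⁻¹ • innerSL ℝ z) z := by
  have h1 : HasFDerivAt (fun y : E => √(‖y‖ ^ 2))
      ((1 / (2 * √(‖z‖ ^ 2))) • (2 • innerSL ℝ z)) z :=
    ((hasStrictFDerivAt_norm_sq z).hasFDerivAt).sqrt (by simpa using hz)
  simp only [Real.sqrt_sq (norm_nonneg _)] at h1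
  convert h1 using 1
  ext v
  have : ‖z‖ ≠ 0 := by simpa using hz
  simp
  field_simp

/-- The gradient of `z ↦ p ‖z‖`. -/
lemma hasFDerivAt_comp_norm (h : IsRadialProfile p p₁ p₂ C) {z : E} (hz : ‖z‖ < 1) :
    HasFDerivAt (fun y : E => p ‖y‖) (radialSlope p₁ p₂ ‖z‖ • innerSL ℝ z) z := by
  have hmem : ‖z‖ ∈ Ioo (-1 : ℝ) 1 := ⟨by linarith [norm_nonneg z], hz⟩
  rcases eq_or_ne z 0 with rfl | h0
  · have h1 := (h.deriv₁ 0 (by simp)).isLittleO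
    rw [hasFDerivAt_iff_isLittleO_nhds_zero]
    have h2 : Tendsto (fun y : E => ‖y‖) (𝓝 0) (𝓝 0) := by
      simpa using (continuous_norm (E := E)).tendsto 0
    have h3 := h1.comp_tendsto h2
    simp only [h.deriv_zero, Function.comp_def, sub_zero, smul_zero] at h3
    simpa using Asymptotics.isLittleO_norm_right.1 h3
  · have := (h.deriv₁ _ hmem).comp_hasFDerivAt z (hasFDerivAt_norm_of_ne_zero h0)
    refine this.congr_fderiv ?_
    have h0' : ‖z‖ ≠ 0 := by simpa using h0
    rw [smul_smul, radialSlope, if_neg h0', div_eq_mul_inv]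

/-- The derivative of the gradient of `z ↦ p ‖z‖`. -/
lemma hasFDerivAt_gradient (h : IsRadialProfile p p₁ p₂ C) {z : E} (hz : ‖z‖ < 1) :
    HasFDerivAt (fun y : E => radialSlope p₁ p₂ ‖y‖ • y)
      (radialSlope p₁ p₂ ‖z‖ • ContinuousLinearMap.id ℝ E +
        ((p₂ ‖z‖ - radialSlope p₁ p₂ ‖z‖) / ‖z‖ ^ 2) • (innerSL ℝ z).smulRight z) z := by
  have hmem : ‖z‖ ∈ Ioo (-1 : ℝ) 1 := ⟨by linarith [norm_nonneg z], hz⟩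
  rcases eq_or_ne z 0 with rfl | h0
  · have h1 := (h.deriv₂ 0 (by simp)).isLittleO
    rw [hasFDerivAt_iff_isLittleO_nhds_zero]
    have h2 : Tendsto (fun y : E => ‖y‖) (𝓝 0) (𝓝 0) := by
      simpa using (continuous_norm (E := E)).tendsto 0
    have h3 := (h1.comp_tendsto h2)
    simp only [h.deriv_zero, Function.comp_def, sub_zero] at h3
    refine Asymptotics.IsLittleO.of_norm_left ?_
    have h4 := h3.norm_left.norm_right
    simp only [norm_norm] at h4
    refine (Asymptotics.isLittleO_norm_right.1 h4).congr_left fun y => ?_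
    simp only [zero_add, smul_zero, sub_zero, norm_zero]
    have e0 : radialSlope p₁ p₂ 0 = p₂ 0 := by simp [radialSlope]
    rw [← h.radialSlope_mul ‖y‖]
    simp only [e0, smul_eq_mul, smul_apply,
      ContinuousLinearMap.id_apply, map_zero, sub_self, zero_div, zero_smul, add_zero]
    rw [← sub_smul, norm_smul, mul_comm ‖y‖, ← sub_mul, norm_mul, norm_norm]
  · have h0' : ‖z‖ ≠ 0 := by simpa using h0
    have hn := hasFDerivAt_norm_of_ne_zero h0
    have h1 : HasFDerivAt (fun y : E => p₁ ‖y‖ / ‖y‖) _ z :=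
      ((h.deriv₂ _ hmem).div (hasDerivAt_id _) h0').comp_hasFDerivAt z hn
    have h2 : HasFDerivAt (fun y : E => radialSlope p₁ p₂ ‖y‖) _ z :=
      h1.congr_of_eventuallyEq (by
        filter_upwards [isOpen_ne.mem_nhds h0] with y hy
        rw [radialSlope, if_neg (by simpa using hy)])
    refine (h2.smul (hasFDerivAt_id z)).congr_fderiv ?_
    ext v
    simp only [radialSlope, if_neg h0']
    simp
    rw [smul_smul]
    congr 1
    field_simp

variable {n k : ℕ}

/-- The Laplacian of `y ↦ p ‖X y‖` where the derivative `X'` of `X` satisfies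
`(X')ᵀ X = c X`. -/
lemma hasLapAt (h : IsRadialProfile p p₁ p₂ C) (c : ℝ)
    {X : EuclideanSpace ℝ (Fin n) → EuclideanSpace ℝ (Fin n)}
    {X' : EuclideanSpace ℝ (Fin n) →L[ℝ] EuclideanSpace ℝ (Fin n)}
    {x : EuclideanSpace ℝ (Fin n)} {f : EuclideanSpace ℝ (Fin n) → ℝ}
    (hf : ∀ᶠ y in 𝓝 x, f y = p ‖X y‖)
    (hX : ∀ᶠ y in 𝓝 x, ∃ Y : EuclideanSpace ℝ (Fin n) →L[ℝ] EuclideanSpace ℝ (Fin n),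
      HasFDerivAt X Y y ∧ ∀ v, ⟪X y, Y v⟫ = c * ⟪X y, v⟫)
    (hX' : HasFDerivAt X X' x) (hx : ‖X x‖ < 1) :
    HasLapAt f (c * (radialSlope p₁ p₂ ‖X x‖ * (∑ i, X' (EuclideanSpace.single i 1) i) +
      (p₂ ‖X x‖ - radialSlope p₁ p₂ ‖X x‖) * c)) x := by
  set N : EuclideanSpace ℝ (Fin n) → EuclideanSpace ℝ (Fin n) :=
    fun y => radialSlope p₁ p₂ ‖y‖ • y with hN
  have hN' := h.hasFDerivAt_gradient hx
  set N' := radialSlope p₁ p₂ ‖X x‖ • ContinuousLinearMap.id ℝ (EuclideanSpace ℝ (Fin n)) +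
        ((p₂ ‖X x‖ - radialSlope p₁ p₂ ‖X x‖) / ‖X x‖ ^ 2) • (innerSL ℝ (X x)).smulRight (X x)
    with hN'def
  have hlt : ∀ᶠ y in 𝓝 x, ‖X y‖ < 1 := hX'.continuousAt.norm.eventually (gt_mem_nhds hx)
  have hA : HasHessAt f ((innerSL ℝ) ∘L (c • (N' ∘L X'))) x := by
    refine ⟨fun y => innerSL ℝ (c • N (X y)), ?_, ?_⟩
    · filter_upwards [hf.eventually_nhds, hX, hlt] with y h1 ⟨Y, h2, h3⟩ h4
      refine (((h.hasFDerivAt_comp_norm h4).comp y h2).congr_of_eventuallyEq h1).congr_fderiv ?_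
      ext v
      simp [hN, h3]
      ring
    · exact (innerSL ℝ).hasFDerivAt.comp x ((hN'.comp x hX').const_smul c)
  refine ⟨⟨_, hA⟩, ?_⟩
  rw [hA.lap_eq]
  obtain ⟨Y, hY1, hY2⟩ := hX.self_of_nhds
  obtain rfl := hY1.unique hX'
  have hterm : ∀ v w, ((innerSL ℝ) ∘L (c • (N' ∘L Y))) v w =
      c * (radialSlope p₁ p₂ ‖X x‖ * ⟪Y v, w⟫ +
        (p₂ ‖X x‖ - radialSlope p₁ p₂ ‖X x‖) / ‖X x‖ ^ 2 * ((c * ⟪X x, v⟫) * ⟪X x, w⟫)) := by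
    intro v w
    change ⟪c • (radialSlope p₁ p₂ ‖X x‖ • Y v +
      ((p₂ ‖X x‖ - radialSlope p₁ p₂ ‖X x‖) / ‖X x‖ ^ 2) • (⟪X x, Y v⟫ • X x)), w⟫ = _
    rw [hY2, real_inner_smul_left, inner_add_left, real_inner_smul_left, real_inner_smul_left,
      real_inner_smul_left]
  simp only [hterm, EuclideanSpace.inner_single_right]
  simp only [conj_trivial, one_mul]
  rw [← Finset.mul_sum, Finset.sum_add_distrib, ← Finset.mul_sum, ← Finset.mul_sum]
  have hsq : ∑ i, c * X x i * X x i = c * ‖X x‖ ^ 2 := by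
    rw [EuclideanSpace.norm_sq_eq, Finset.mul_sum]
    refine Finset.sum_congr rfl fun i _ => ?_
    rw [Real.norm_eq_abs, sq_abs]; ring
  rw [hsq]
  by_cases h0 : ‖X x‖ = 0
  · simp [h0, radialSlope]
  · field_simp

end IsRadialProfile

lemma exists_isRadialProfile {m : ℕ} (hm : 0 < m) {U : EuclideanSpace ℝ (Fin m) → ℝ} {U₀ : ℝ → ℝ}
    (hUrad : ∀ z, U z = U₀ ‖z‖) (hU : ContDiffOn ℝ 2 U (closedBall 0 1)) :
    ∃ p p₁ p₂ C, IsRadialProfile p p₁ p₂ C ∧ (∀ r, 0 ≤ r → p r = U₀ r) ∧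
      ∀ z ∈ ball (0 : EuclideanSpace ℝ (Fin m)) 1,
        lap U z = p₂ ‖z‖ + (m - 1) * radialSlope p₁ p₂ ‖z‖ := by
  set e : EuclideanSpace ℝ (Fin m) := EuclideanSpace.single ⟨0, hm⟩ 1 with he
  have hen : ‖e‖ = 1 := by simp [he]
  set p : ℝ → ℝ := fun r => U (r • e) with hp
  have hpU : ∀ r, p r = U₀ |r| := fun r => by simp [hp, hUrad, norm_smul, hen]
  have hpC : ContDiffOn ℝ 2 p (Icc (-1) 1) := by
    refine hU.comp (by fun_prop) fun r hr => ?_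
    simpa [norm_smul, hen, abs_le] using hr
  have hud : UniqueDiffOn ℝ (Icc (-1 : ℝ) 1) := uniqueDiffOn_Icc (by norm_num)
  set q : ℝ → ℝ := derivWithin p (Icc (-1) 1) with hq
  have hqC : ContDiffOn ℝ 1 q (Icc (-1) 1) := hpC.derivWithin hud (by norm_num)
  have hqC' : ContinuousOn (derivWithin q (Icc (-1) 1)) (Icc (-1) 1) :=
    (hqC.derivWithin (m := 0) hud (by norm_num)).continuousOn
  obtain ⟨C, hC⟩ := isCompact_Icc.exists_bound_of_continuousOn hqC'
  have hmem : ∀ r ∈ Ioo (-1 : ℝ) 1, Icc (-1 : ℝ) 1 ∈ 𝓝 r := fun r hr => Icc_mem_nhds hr.1 hr.2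
  have hprof : IsRadialProfile p q (derivWithin q (Icc (-1) 1)) C := by
    refine ⟨fun r => by simp [hpU], fun r hr => ?_, fun r hr => ?_, fun r hr => ?_⟩
    · exact ((hpC.differentiableOn (by simp)) r (Ioo_subset_Icc_self hr)).hasDerivWithinAt.hasDerivAt
        (hmem r hr)
    · exact ((hqC.differentiableOn (by simp)) r (Ioo_subset_Icc_self hr)).hasDerivWithinAt.hasDerivAt
        (hmem r hr)
    · exact hC r (Ioo_subset_Icc_self hr)
  refine ⟨p, q, _, C, hprof, fun r hr => by rw [hpU, abs_of_nonneg hr], fun z hz => ?_⟩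
  have := (hprof.hasLapAt (n := m) 1 (X := id) (X' := .id ℝ _) (x := z) (f := U)
    (.of_forall fun y => by simp [hpU, hUrad])
    (.of_forall fun y => ⟨.id ℝ _, hasFDerivAt_id _, by simp⟩) (hasFDerivAt_id _)
    (by simpa using hz)).2
  rw [this]
  simp
  ring

section Positivity

/-- A regularised positive part `g` together with the primitive `h` of `(g')²`. -/
lemma exists_regularised_posPart {δ : ℝ} (hδ : 0 < δ) :
    ∃ g h θ : ℝ → ℝ, Continuous θ ∧ (∀ s, HasDerivAt g (θ s) s) ∧
      (∀ s, HasDerivAt h (θ s ^ 2) s) ∧ (∀ s ≤ δ, g s = 0 ∧ h s = 0 ∧ θ s = 0) ∧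
      (∀ s, δ < s → 0 < h s) ∧ ∀ s, s * h s - g s ^ 2 ≤ 2 * δ * h s := by
  set θ : ℝ → ℝ := fun s => Real.smoothTransition ((s - δ) / δ) with hθ
  have hθc : Continuous θ := Real.smoothTransition.continuous.comp (by fun_prop)
  have hθ0 : ∀ s ≤ δ, θ s = 0 := fun s hs =>
    Real.smoothTransition.zero_of_nonpos (div_nonpos_of_nonpos_of_nonneg (by linarith) hδ.le)
  have hθ1 : ∀ s, 2 * δ ≤ s → θ s = 1 := fun s hs =>
    Real.smoothTransition.one_of_one_le (by rw [le_div_iff₀ hδ]; linarith)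
  have hθnn : ∀ s, 0 ≤ θ s := fun s => Real.smoothTransition.nonneg _
  have hθle : ∀ s, θ s ≤ 1 := fun s => Real.smoothTransition.le_one _
  have hθpos : ∀ s, δ < s → 0 < θ s := fun s hs =>
    Real.smoothTransition.pos_of_pos (div_pos (by linarith) hδ)
  have hθ2c : Continuous fun s => θ s ^ 2 := hθc.pow 2
  have hi : ∀ a b, IntervalIntegrable θ volume a b := fun a b => hθc.intervalIntegrable a b
  have hi2 : ∀ a b, IntervalIntegrable (fun s => θ s ^ 2) volume a b :=
    fun a b => hθ2c.intervalIntegrable a b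
  have hz : ∀ s ≤ δ, (∫ t in δ..s, θ t) = 0 ∧ (∫ t in δ..s, θ t ^ 2) = 0 := by
    intro s hs
    constructor <;>
    · rw [intervalIntegral.integral_congr (g := fun _ => 0)]
      · simp
      · intro t ht
        rw [uIcc_of_ge hs] at ht
        simp [hθ0 t ht.2]
  have hpos : ∀ s, δ < s → 0 < ∫ t in δ..s, θ t ^ 2 := fun s hs =>
    intervalIntegral.intervalIntegral_pos_of_pos_on (hi2 _ _)
      (fun t ht => pow_pos (hθpos t ht.1) 2) hs
  refine ⟨fun s => ∫ t in δ..s, θ t, fun s => ∫ t in δ..s, θ t ^ 2, θ, hθc,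
    fun s => hθc.integral_hasStrictDerivAt δ s |>.hasDerivAt,
    fun s => hθ2c.integral_hasStrictDerivAt δ s |>.hasDerivAt,
    fun s hs => ⟨(hz s hs).1, (hz s hs).2, hθ0 s hs⟩, hpos, fun s => ?_⟩
  rcases le_or_gt s δ with hs | hs
  · simp [hz s hs]
  have hhg : (∫ t in δ..s, θ t ^ 2) ≤ ∫ t in δ..s, θ t :=
    intervalIntegral.integral_mono_on hs.le (hi2 _ _) (hi _ _) fun t _ => by
      nlinarith [hθnn t, hθle t]
  have hsg : s ≤ (∫ t in δ..s, θ t) + 2 * δ := by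
    rcases le_or_gt s (2 * δ) with h2 | h2
    · linarith [hpos s hs]
    · have e1 : (∫ t in δ..s, θ t) = (∫ t in δ..(2 * δ), θ t) + ∫ t in (2 * δ)..s, θ t :=
        (intervalIntegral.integral_add_adjacent_intervals (hi _ _) (hi _ _)).symm
      have e2 : (∫ t in (2 * δ)..s, θ t) = s - 2 * δ := by
        rw [intervalIntegral.integral_congr (g := fun _ => 1)]
        · simp
        · intro t ht
          rw [uIcc_of_le h2.le] at ht
          exact hθ1 t ht.1
      have e3 : 0 ≤ ∫ t in δ..(2 * δ), θ t :=
        intervalIntegral.integral_nonneg (by linarith) fun t _ => hθnn t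
      linarith
  have := hpos s hs
  simp only
  nlinarith [mul_le_mul_of_nonneg_right hsg this.le]

lemma integrable_of_continuousOn_of_eq_zero {E : Type*} [TopologicalSpace E] [T2Space E]
    [MeasurableSpace E] [BorelSpace E] {μ : Measure E} [IsFiniteMeasureOnCompacts μ] {K : Set E}
    (hK : IsCompact K) {F : E → ℝ} (hF : ContinuousOn F K) (h0 : ∀ x, x ∉ K → F x = 0) :
    Integrable F μ :=
  (integrableOn_iff_integrable_of_support_subset fun x hx => by
    by_contra hxK; exact hx (h0 x hxK)).1 (hF.integrableOn_compact hK)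

lemma contDiff_indicator_of_eq_zero {E : Type*} [NormedAddCommGroup E] [NormedSpace ℝ E]
    {O K : Set E} (hO : IsOpen O) (hK : IsCompact K) {k : WithTop ℕ∞} {F : E → ℝ}
    (hKO : K ⊆ O) (hF : ContDiffOn ℝ k F O) (h0 : ∀ x ∈ O, x ∉ K → F x = 0) :
    ContDiff ℝ k (O.indicator F) ∧ tsupport (O.indicator F) ⊆ K := by
  constructor
  · rw [contDiff_iff_contDiffAt]
    intro x
    by_cases hx : x ∈ O
    · exact (hF.contDiffAt (hO.mem_nhds hx)).congr_of_eventuallyEq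
        (by filter_upwards [hO.mem_nhds hx] with y hy using by simp [hy])
    · refine (contDiffAt_const (c := 0)).congr_of_eventuallyEq ?_
      filter_upwards [hK.isClosed.isOpen_compl.mem_nhds fun h => hx (hKO h)] with y hy
      by_cases hyO : y ∈ O
      · simp [hyO, h0 y hyO hy]
      · simp [hyO]
  · refine closure_minimal (fun x hx => ?_) hK.isClosed
    by_contra hxK
    refine hx ?_
    by_cases hxO : x ∈ O
    · simp [hxO, h0 x hxO hxK]
    · simp [hxO]

end Positivity

lemma norm_sq_dual_eq_sum {m : ℕ} (L : EuclideanSpace ℝ (Fin m) →L[ℝ] ℝ) :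
    ‖L‖ ^ 2 = ∑ i, L (EuclideanSpace.single i 1) ^ 2 := by
  set y := (InnerProductSpace.toDual ℝ (EuclideanSpace ℝ (Fin m))).symm L with hy
  have h1 : ‖L‖ = ‖y‖ := by rw [hy, LinearIsometryEquiv.norm_map]
  have h2 : ∀ v, L v = ⟪y, v⟫ := fun v => by
    rw [hy, InnerProductSpace.toDual_symm_apply]
  rw [h1, EuclideanSpace.norm_sq_eq]
  refine Finset.sum_congr rfl fun i _ => ?_
  rw [h2, EuclideanSpace.inner_single_right]
  simp

lemma lap_eq_sum_fderiv_fderiv {m : ℕ} (W : EuclideanSpace ℝ (Fin m) → ℝ)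
    {z : EuclideanSpace ℝ (Fin m)} (h : DifferentiableAt ℝ (fderiv ℝ W) z) :
    lap W z = ∑ i, fderiv ℝ (fun y => fderiv ℝ W y (EuclideanSpace.single i 1)) z
      (EuclideanSpace.single i 1) := by
  unfold lap
  refine Finset.sum_congr rfl fun i _ => ?_
  rw [iteratedFDeriv_two_apply, fderiv_clm_apply h (by fun_prop)]
  simp

/-- If the Gelfand potential `λ e^U` is stable on the unit ball, the solution of
`-ΔW - λ e^U W = 1` with zero boundary values is nonnegative. -/
lemma nonneg_of_stable {m : ℕ} {lam : ℝ} (hlam : 0 < lam) {U W : EuclideanSpace ℝ (Fin m) → ℝ}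
    (hU : ContinuousOn U (closedBall 0 1))
    (hstab : ∀ φ : EuclideanSpace ℝ (Fin m) → ℝ, ContDiff ℝ 1 φ → HasCompactSupport φ →
      tsupport φ ⊆ ball 0 1 →
      lam * ∫ z in ball (0 : EuclideanSpace ℝ (Fin m)) 1, exp (U z) * φ z ^ 2 ≤
        ∫ z in ball (0 : EuclideanSpace ℝ (Fin m)) 1, ‖gradient φ z‖ ^ 2)
    (hW : ContDiffOn ℝ 2 W (closedBall 0 1))
    (hWsol : ∀ z ∈ ball (0 : EuclideanSpace ℝ (Fin m)) 1, -(lap W z) - lam * exp (U z) * W z = 1)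
    (hWbdry : ∀ z ∈ sphere (0 : EuclideanSpace ℝ (Fin m)) 1, W z = 0) :
    ∀ z ∈ ball (0 : EuclideanSpace ℝ (Fin m)) 1, 0 ≤ W z := by
  intro z₀ hz₀
  by_contra! hneg
  set O := ball (0 : EuclideanSpace ℝ (Fin m)) 1 with hO
  have hOo : IsOpen O := isOpen_ball
  obtain ⟨M, hM⟩ := (isCompact_closedBall (0 : EuclideanSpace ℝ (Fin m)) 1).exists_bound_of_continuousOn
    (f := fun z => lam * exp (U z)) (by fun_prop)
  have hM' : ∀ z ∈ O, lam * exp (U z) ≤ M := fun z hz =>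
    (le_abs_self _).trans (hM z (ball_subset_closedBall hz))
  have hM0 : 0 < M := lt_of_lt_of_le (by positivity) (hM' z₀ hz₀)
  obtain ⟨δ, hδ, hδ1, hδ2⟩ : ∃ δ > 0, δ < -W z₀ ∧ 2 * δ * M ≤ 1 / 2 := by
    refine ⟨min (-W z₀ / 2) (1 / (4 * M)), lt_min (by linarith) (by positivity),
      (min_le_left _ _).trans_lt (by linarith), ?_⟩
    have := min_le_right (-W z₀ / 2) (1 / (4 * M))
    rw [le_div_iff₀ (by positivity)] at this
    linarith
  obtain ⟨g, h, θ, hθc, hg, hh, hzero, hpos, hkey⟩ := exists_regularised_posPart hδ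
  have hgC : ContDiff ℝ 1 g := contDiff_one_iff_deriv.2
    ⟨fun s => (hg s).differentiableAt, by rwa [show deriv g = θ from funext fun s => (hg s).deriv]⟩
  have hhC : ContDiff ℝ 1 h := contDiff_one_iff_deriv.2
    ⟨fun s => (hh s).differentiableAt, by
      rw [show deriv h = fun s => θ s ^ 2 from funext fun s => (hh s).deriv]
      exact hθc.pow 2⟩
  set K := closedBall (0 : EuclideanSpace ℝ (Fin m)) 1 ∩ W ⁻¹' Iic (-δ) with hKdef
  have hK : IsCompact K := (isCompact_closedBall _ _).of_isClosed_subset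
    (hW.continuousOn.preimage_isClosed_of_isClosed isClosed_closedBall isClosed_Iic)
    inter_subset_left
  have hKO : K ⊆ O := by
    rintro z ⟨hz1, hz2⟩
    by_contra hzO
    have hs : z ∈ sphere (0 : EuclideanSpace ℝ (Fin m)) 1 := by
      simp only [hO, mem_ball, not_lt, mem_closedBall, mem_sphere] at *
      exact le_antisymm hz1 hzO
    have : W z ≤ -δ := hz2
    rw [hWbdry z hs] at this
    linarith
  have hoff : ∀ z ∈ O, z ∉ K → -W z ≤ δ := fun z hz hzK => by
    by_contra! hlt
    exact hzK ⟨ball_subset_closedBall hz, by simp only [mem_preimage, mem_Iic]; linarith⟩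
  have hWO : ContDiffOn ℝ 2 W O := hW.mono ball_subset_closedBall
  have hWcd : ∀ z ∈ O, ContDiffAt ℝ 2 W z := fun z hz => hWO.contDiffAt (hOo.mem_nhds hz)
  have hWd : ∀ z ∈ O, HasFDerivAt W (fderiv ℝ W z) z := fun z hz =>
    ((hWcd z hz).differentiableAt (by simp)).hasFDerivAt
  have hWf : ContDiffOn ℝ 1 (fderiv ℝ W) O := hWO.fderiv_of_isOpen hOo (by norm_num)
  have hsC : ContDiffOn ℝ 1 (fun z => -W z) O := (hWO.of_le (by norm_num)).neg
  obtain ⟨hφ1, hφ2⟩ := contDiff_indicator_of_eq_zero hOo hK (F := fun z => g (-W z)) hKO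
    (hgC.comp_contDiffOn hsC) (fun z hz hzK => (hzero _ (hoff z hz hzK)).1)
  obtain ⟨hf1, hf2⟩ := contDiff_indicator_of_eq_zero hOo hK (F := fun z => h (-W z)) hKO
    (hhC.comp_contDiffOn hsC) (fun z hz hzK => (hzero _ (hoff z hz hzK)).2.1)
  set φ := O.indicator fun z => g (-W z) with hφ
  set f := O.indicator fun z => h (-W z) with hf
  have hfO : ∀ z ∈ O, f z = h (-W z) := fun z hz => by simp [hf, hz]
  have hφO : ∀ z ∈ O, φ z = g (-W z) := fun z hz => by simp [hφ, hz]
  have hfd : ∀ z ∈ O, HasFDerivAt f (θ (-W z) ^ 2 • (-fderiv ℝ W z)) z := fun z hz =>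
    ((hh _).comp_hasFDerivAt z (hWd z hz).neg).congr_of_eventuallyEq
      (by filter_upwards [hOo.mem_nhds hz] with y hy using hfO y hy)
  have hφd : ∀ z ∈ O, HasFDerivAt φ (θ (-W z) • (-fderiv ℝ W z)) z := fun z hz =>
    ((hg _).comp_hasFDerivAt z (hWd z hz).neg).congr_of_eventuallyEq
      (by filter_upwards [hOo.mem_nhds hz] with y hy using hφO y hy)
  have hfK : ∀ z, z ∉ K → f z = 0 := fun z hz => image_eq_zero_of_notMem_tsupport fun h => hz (hf2 h)
  have hφK : ∀ z, z ∉ K → φ z = 0 := fun z hz => image_eq_zero_of_notMem_tsupport fun h => hz (hφ2 h)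
  have hfK' : ∀ z, z ∉ K → fderiv ℝ f z = 0 := fun z hz =>
    image_eq_zero_of_notMem_tsupport fun h => hz (hf2 (tsupport_fderiv_subset ℝ h))
  have hfcs : HasCompactSupport f := hK.of_isClosed_subset (isClosed_tsupport _) hf2
  have hφcs : HasCompactSupport φ := hK.of_isClosed_subset (isClosed_tsupport _) hφ2
  set e : Fin m → EuclideanSpace ℝ (Fin m) := fun i => EuclideanSpace.single i 1 with he
  set G : Fin m → EuclideanSpace ℝ (Fin m) → ℝ := fun i z => fderiv ℝ W z (e i) with hG
  have hGC : ∀ i, ContDiffOn ℝ 1 (G i) O := fun i => hWf.clm_apply contDiffOn_const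
  have hint1 : ∀ i, Integrable fun z => fderiv ℝ f z (e i) * G i z := fun i =>
    integrable_of_continuousOn_of_eq_zero hK
      ((((hf1.continuous_fderiv (by simp)).clm_apply continuous_const).continuousOn).mul
        ((hGC i).continuousOn.mono hKO)) fun z hz => by simp [hfK' z hz]
  have hint1' : ∀ i, Integrable fun z => -(fderiv ℝ f z (e i) * G i z) := fun i => (hint1 i).neg
  have hint2 : ∀ i, Integrable fun z => f z * fderiv ℝ (G i) z (e i) := fun i =>
    integrable_of_continuousOn_of_eq_zero hK
      (hf1.continuous.continuousOn.mul
        (((((hGC i).fderiv_of_isOpen (m := 0) hOo (by norm_num)).continuousOn).clm_apply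
          continuousOn_const).mono hKO)) fun z hz => by simp [hfK z hz]
  have hint3 : ∀ i, Integrable fun z => f z * G i z := fun i =>
    integrable_of_continuousOn_of_eq_zero hK
      (hf1.continuous.continuousOn.mul ((hGC i).continuousOn.mono hKO))
      fun z hz => by simp [hfK z hz]
  have hibp : ∀ i, ∫ z, f z * fderiv ℝ (G i) z (e i) = -∫ z, fderiv ℝ f z (e i) * G i z := fun i =>
    integral_mul_fderiv_eq_neg_fderiv_mul_of_integrable (hint1 i) (hint2 i) (hint3 i)
      (fun z _ => hf1.differentiable (by simp) z)
      (fun z hz => ((hGC i).contDiffAt (hOo.mem_nhds (hKO (hf2 hz)))).differentiableAt (by simp))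
  have hgrad : ∫ z in O, ‖gradient φ z‖ ^ 2 = ∫ z in O, f z * lap W z := by
    have e1 : ∫ z in O, ‖gradient φ z‖ ^ 2 = ∫ z in O, ∑ i, -(fderiv ℝ f z (e i) * G i z) := by
      refine setIntegral_congr_fun measurableSet_ball fun z hz => ?_
      rw [gradient, LinearIsometryEquiv.norm_map, norm_sq_dual_eq_sum, (hφd z hz).fderiv,
        (hfd z hz).fderiv]
      refine Finset.sum_congr rfl fun i _ => ?_
      simp [hG]
      ring
    have e2 : ∫ z in O, f z * lap W z = ∫ z in O, ∑ i, f z * fderiv ℝ (G i) z (e i) := by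
      refine setIntegral_congr_fun measurableSet_ball fun z hz => ?_
      rw [lap_eq_sum_fderiv_fderiv W
        ((hWf.contDiffAt (hOo.mem_nhds hz)).differentiableAt (by simp)), Finset.mul_sum]
    rw [e1, e2, setIntegral_eq_integral_of_forall_compl_eq_zero fun z hz => ?_,
      setIntegral_eq_integral_of_forall_compl_eq_zero fun z hz => ?_,
      integral_finsetSum _ fun i _ => hint1' i, integral_finsetSum _ fun i _ => hint2 i]
    · refine Finset.sum_congr rfl fun i _ => ?_
      rw [hibp, integral_neg]
    · simp [hfK z fun h => hz (hKO h)]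
    · simp [hfK' z fun h => hz (hKO h)]
  have hstab' := hstab φ hφ1 hφcs (hφ2.trans hKO)
  rw [hgrad, ← integral_const_mul] at hstab'
  have hUK : ContinuousOn U K := hU.mono inter_subset_left
  have hI1 : IntegrableOn (fun z => lam * (exp (U z) * φ z ^ 2)) O :=
    (integrable_of_continuousOn_of_eq_zero hK (by
      have := hφ1.continuous.continuousOn (s := K); fun_prop)
      fun z hz => by simp [hφK z hz]).integrableOn
  have hI2 : IntegrableOn (fun z => f z * (-1 - lam * exp (U z) * W z)) O :=
    (integrable_of_continuousOn_of_eq_zero hK (by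
      have := hf1.continuous.continuousOn (s := K)
      have := hWO.continuousOn.mono hKO
      fun_prop)
      fun z hz => by simp [hfK z hz]).integrableOn
  have hlapW : ∫ z in O, f z * lap W z = ∫ z in O, f z * (-1 - lam * exp (U z) * W z) :=
    setIntegral_congr_fun measurableSet_ball fun z hz => by
      rw [show lap W z = -1 - lam * exp (U z) * W z by linarith [hWsol z hz]]
  have hfint : Integrable f := hf1.continuous.integrable_of_hasCompactSupport hfcs
  have hfnn : ∀ z, 0 ≤ f z := fun z => by
    by_cases hz : z ∈ O
    · rw [hfO z hz]
      rcases le_or_gt (-W z) δ with h1 | h1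
      · exact (hzero _ h1).2.1.ge
      · exact (hpos _ h1).le
    · simp [hf, hz]
  have hle : ∫ z in O, (f z * (-1 - lam * exp (U z) * W z) - lam * (exp (U z) * φ z ^ 2)) ≤
      ∫ z in O, -(1 / 2) * f z := by
    refine setIntegral_mono_on (hI2.sub hI1) (hfint.integrableOn.const_mul _) measurableSet_ball
      fun z hz => ?_
    have k1 := hkey (-W z)
    rw [← hfO z hz, ← hφO z hz] at k1
    have k2 := hM' z hz
    have k3 : 0 < lam * exp (U z) := by positivity
    have k4 := mul_le_mul_of_nonneg_left k1 k3.le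
    have k5 := mul_le_mul_of_nonneg_right k2 (mul_nonneg (by positivity : 0 ≤ 2 * δ) (hfnn z))
    have k6 := mul_le_mul_of_nonneg_right hδ2 (hfnn z)
    linarith
  have hr : ∫ z in O, -(1 / 2) * f z = -(1 / 2) * ∫ z, f z := by
    rw [integral_const_mul,
      setIntegral_eq_integral_of_forall_compl_eq_zero fun z hz => hfK z fun h => hz (hKO h)]
  rw [integral_sub hI2 hI1, hr] at hle
  have hfpos : 0 < ∫ z, f z :=
    hf1.continuous.integral_pos_of_hasCompactSupport_nonneg_nonzero hfcs hfnn (x := z₀)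
      (by rw [hfO z₀ hz₀]; exact (hpos _ hδ1).ne')
  rw [hlapW] at hstab'
  linarith

section Curve

/-- A continuous curve of period `1` that is injective modulo the period is quantitatively so. -/
lemma exists_int_abs_sub_lt_of_dist_lt {E : Type*} [MetricSpace E] {γ : ℝ → E}
    (hc : Continuous γ) (hper : Function.Periodic γ 1)
    (hinj : ∀ s t : ℝ, γ s = γ t → ∃ k : ℤ, s - t = (k : ℝ)) {η : ℝ} (hη : 0 < η) :
    ∃ ρ > 0, ∀ s t, dist (γ s) (γ t) < ρ → ∃ k : ℤ, |s - t - k| < η := by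
  set S : Set (ℝ × ℝ) := (Icc 0 1 ×ˢ Icc 0 1) ∩ ⋂ k : ℤ, {q | η ≤ |q.1 - q.2 - k|} with hS
  have hScpt : IsCompact S := by
    refine (isCompact_Icc.prod isCompact_Icc).inter_right (isClosed_iInter fun k => ?_)
    exact isClosed_le continuous_const (by fun_prop)
  have hfract : ∀ s, γ (Int.fract s) = γ s := fun s => by
    have := hper.sub_int_mul_eq ⌊s⌋ (x := s)
    rwa [mul_one] at this
  obtain ⟨ρ, hρ, hle⟩ : ∃ ρ > 0, ∀ q ∈ S, ρ ≤ dist (γ q.1) (γ q.2) := by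
    refine hScpt.exists_forall_le' (f := fun q : ℝ × ℝ => dist (γ q.1) (γ q.2))
      (by fun_prop) (a := 0) fun q hq => ?_
    rw [dist_pos]
    intro heq
    obtain ⟨k, hk⟩ := hinj _ _ heq
    have : η ≤ |q.1 - q.2 - k| := mem_iInter.1 hq.2 k
    rw [hk, sub_self, abs_zero] at this
    linarith
  refine ⟨ρ, hρ, fun s t hst => ?_⟩
  by_contra! hfar
  have hmem : (Int.fract s, Int.fract t) ∈ S := by
    refine ⟨⟨⟨Int.fract_nonneg s, (Int.fract_lt_one s).le⟩,
      ⟨Int.fract_nonneg t, (Int.fract_lt_one t).le⟩⟩, mem_iInter.2 fun k => ?_⟩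
    have := hfar (k + ⌊s⌋ - ⌊t⌋)
    have e : Int.fract s - Int.fract t - k = s - t - ((k + ⌊s⌋ - ⌊t⌋ : ℤ) : ℝ) := by
      simp only [Int.fract]
      push_cast
      ring
    rwa [← e] at this
  have := hle _ hmem
  simp only [hfract] at this
  linarith

lemma Function.Periodic.exists_norm_le_s17 {F : Type*} [NormedAddCommGroup F] {f : ℝ → F}
    (hp : Function.Periodic f 1) (hf : Continuous f) : ∃ M > 0, ∀ t, ‖f t‖ ≤ M := by
  obtain ⟨M, hM, h⟩ := (hp.isBounded_of_continuous one_ne_zero hf).exists_pos_norm_le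
  exact ⟨M, hM, fun t => h _ (mem_range_self t)⟩

variable {E : Type*} [NormedAddCommGroup E] [InnerProductSpace ℝ E]
  {γ γ₁ γ₂ : ℝ → E}

lemma hasDerivAt_inner_sub (h₁ : ∀ t, HasDerivAt γ (γ₁ t) t) (h₂ : ∀ t, HasDerivAt γ₁ (γ₂ t) t)
    (y : E) (t : ℝ) :
    HasDerivAt (fun t => ⟪y - γ t, γ₁ t⟫) (⟪y - γ t, γ₂ t⟫ - ‖γ₁ t‖ ^ 2) t := by
  have := ((h₁ t).const_sub y).inner ℝ (h₂ t)
  refine this.congr_deriv ?_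
  rw [inner_neg_left, real_inner_self_eq_norm_sq]
  ring

/-- Local solvability of the equation `⟪y - γ t, γ' t⟫ = 0` for `t`. -/
lemma exists_implicit_parameter [CompleteSpace E] (h₁ : ∀ t, HasDerivAt γ (γ₁ t) t)
    (h₂ : ∀ t, HasDerivAt γ₁ (γ₂ t) t) (hγ : ContDiff ℝ 1 γ) (hγ₁ : ContDiff ℝ 1 γ₁)
    {x : E} {s : ℝ} (h0 : ⟪x - γ s, γ₁ s⟫ = 0) (hne : ⟪x - γ s, γ₂ s⟫ - ‖γ₁ s‖ ^ 2 ≠ 0) :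
    ∃ τ : E → ℝ, τ x = s ∧ ContDiffAt ℝ 1 τ x ∧
      ∀ᶠ y in 𝓝 x, ⟪y - γ (τ y), γ₁ (τ y)⟫ = 0 := by
  set H : E × ℝ → ℝ := fun q => ⟪q.1 - γ q.2, γ₁ q.2⟫ with hH
  have hHc : ContDiff ℝ 1 H :=
    (contDiff_fst.sub (hγ.comp contDiff_snd)).inner ℝ (hγ₁.comp contDiff_snd)
  have hcd : ContDiffAt ℝ 1 H (x, s) := hHc.contDiffAt
  have hd : fderiv ℝ H (x, s) ∘L .inr ℝ E ℝ =
      ContinuousLinearMap.toSpanSingleton ℝ (⟪x - γ s, γ₂ s⟫ - ‖γ₁ s‖ ^ 2) := by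
    have e1 : HasFDerivAt (fun t : ℝ => H (x, t)) (fderiv ℝ H (x, s) ∘L .inr ℝ E ℝ) s :=
      (hcd.differentiableAt (by simp)).hasFDerivAt.comp s (hasFDerivAt_prodMk_right x s)
    exact e1.unique (hasDerivAt_inner_sub h₁ h₂ x s).hasFDerivAt
  have hinv : (fderiv ℝ H (x, s) ∘L .inr ℝ E ℝ).IsInvertible := by
    rw [hd]
    refine ⟨ContinuousLinearEquiv.unitsEquivAut ℝ (Units.mk0 _ hne), ?_⟩
    ext
    simp
  refine ⟨hcd.implicitFunction one_ne_zero hinv, hcd.implicitFunction_apply_self one_ne_zero hinv,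
    hcd.contDiffAt_implicitFunction one_ne_zero hinv, ?_⟩
  filter_upwards [hcd.eventually_apply_implicitFunction one_ne_zero hinv] with y hy
  rw [← h0]
  exact hy

lemma inner_sub_deriv_eq_zero_of_infDist_eq_s17 (h₁ : ∀ t, HasDerivAt γ (γ₁ t) t) {y : E} {t : ℝ}
    (ht : infDist y (range γ) = dist y (γ t)) : ⟪y - γ t, γ₁ t⟫ = 0 := by
  have hmin : IsLocalMin (fun t => ‖y - γ t‖ ^ 2) t := by
    refine Eventually.of_forall fun r => ?_
    have := infDist_le_dist_of_mem (x := y) (mem_range_self (f := γ) r)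
    rw [ht, dist_eq_norm, dist_eq_norm] at this
    simp only
    gcongr
  have := hmin.hasDerivAt_eq_zero ((h₁ t).const_sub y).norm_sq
  rw [inner_neg_right] at this
  linarith

/-- Constants controlling the nearest-point projection onto a closed curve. -/
structure IsTubeScale (γ γ₁ γ₂ : ℝ → E) (m K η ε : ℝ) : Prop where
  pos : 0 < m
  le_norm : ∀ t, m ≤ ‖γ₁ t‖
  norm_le : ∀ t, ‖γ₂ t‖ ≤ K
  scale_pos : 0 < η
  radius_pos : 0 < ε
  near : ∀ s t, dist (γ s) (γ t) < 4 * ε → ∃ k : ℤ, |s - t - k| < η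
  norm_sub_le : ∀ s t, |s - t| ≤ η → (2 * ε + ‖γ s - γ t‖) * K ≤ m ^ 2 / 2

lemma exists_isTubeScale (h₁ : ∀ t, HasDerivAt γ (γ₁ t) t) (hc₁ : Continuous γ₁)
    (hc₂ : Continuous γ₂) (hper : Function.Periodic γ 1) (hper₁ : Function.Periodic γ₁ 1)
    (hper₂ : Function.Periodic γ₂ 1) (hreg : ∀ t, γ₁ t ≠ 0)
    (hinj : ∀ s t : ℝ, γ s = γ t → ∃ k : ℤ, s - t = (k : ℝ)) :
    ∃ m K η ε, IsTubeScale γ γ₁ γ₂ m K η ε := by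
  obtain ⟨L, hL, hL'⟩ := hper₁.exists_norm_le_s17 hc₁
  obtain ⟨K, hK, hK'⟩ := hper₂.exists_norm_le_s17 hc₂
  obtain ⟨M, hM, hM'⟩ := Function.Periodic.exists_norm_le_s17 (f := fun t => ‖γ₁ t‖⁻¹)
    (fun t => by simp only [hper₁ t]) (hc₁.norm.inv₀ fun t => by simpa using hreg t)
  have hlip : ∀ s t, ‖γ s - γ t‖ ≤ L * |s - t| := fun s t =>
    convex_univ.norm_image_sub_le_of_norm_hasDerivWithin_le
      (fun r _ => (h₁ r).hasDerivWithinAt) (fun r _ => hL' r) (mem_univ t) (mem_univ s)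
  set κ := M⁻¹ ^ 2 / (2 * K) with hκ
  have hκpos : 0 < κ := by positivity
  obtain ⟨ρ, hρ, hnear⟩ := exists_int_abs_sub_lt_of_dist_lt
    (continuous_iff_continuousAt.2 fun t => (h₁ t).continuousAt) hper hinj
    (show 0 < κ / (2 * L) by positivity)
  have r1 := min_le_left (κ / 4) (ρ / 4)
  have r2 := min_le_right (κ / 4) (ρ / 4)
  refine ⟨M⁻¹, K, κ / (2 * L), min (κ / 4) (ρ / 4), by positivity, fun t => ?_, hK', by positivity,
    by positivity, fun s t hst => hnear s t (by linarith), fun s t hst => ?_⟩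
  · have := hM' t
    rw [norm_inv, norm_norm] at this
    exact inv_le_of_inv_le₀ (by simpa using hreg t) this
  · have h3 : L * |s - t| ≤ L * (κ / (2 * L)) := by gcongr
    have h4 : L * (κ / (2 * L)) = κ / 2 := by field_simp
    have h5 : κ * K = M⁻¹ ^ 2 / 2 := by rw [hκ]; field_simp
    rw [← h5]
    gcongr
    linarith [hlip s t]

namespace IsTubeScale

variable {m K η ε : ℝ}

lemma slope_le (h : IsTubeScale γ γ₁ γ₂ m K η ε) {y : E} {t : ℝ} (hy : ‖y - γ t‖ * K ≤ m ^ 2 / 2) :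
    ⟪y - γ t, γ₂ t⟫ - ‖γ₁ t‖ ^ 2 ≤ -(m ^ 2 / 2) := by
  have h1 := real_inner_le_norm (y - γ t) (γ₂ t)
  have h2 : ‖y - γ t‖ * ‖γ₂ t‖ ≤ ‖y - γ t‖ * K := by gcongr; exact h.norm_le t
  have h3 : m ^ 2 ≤ ‖γ₁ t‖ ^ 2 := by
    have := h.pos
    have := h.le_norm t
    gcongr
  linarith

/-- Near `x`, a critical parameter close to the one of `x` realises the distance. -/
lemma infDist_eq (h : IsTubeScale γ γ₁ γ₂ m K η ε) (h₁ : ∀ t, HasDerivAt γ (γ₁ t) t)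
    (h₂ : ∀ t, HasDerivAt γ₁ (γ₂ t) t) (hper : Function.Periodic γ 1) {x y : E} {s t r : ℝ}
    (hs : infDist x (range γ) = dist x (γ s)) (hx : infDist x (range γ) < ε)
    (hxy : dist y x < ε) (hts : |t - s| ≤ η) (ht : ⟪y - γ t, γ₁ t⟫ = 0)
    (hr : infDist y (range γ) = dist y (γ r)) : infDist y (range γ) = ‖y - γ t‖ := by
  have h3 : dist (γ r) (γ s) < 4 * ε := by
    have d1 := dist_triangle4 (γ r) y x (γ s)
    have d2 : infDist y (range γ) ≤ infDist x (range γ) + dist y x := infDist_le_infDist_add_dist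
    rw [dist_comm (γ r) y, ← hs, ← hr] at d1
    linarith
  obtain ⟨k, hk⟩ := h.near r s h3
  have hrk : γ (r - k) = γ r := by simpa using hper.sub_int_mul_eq k (x := r)
  rw [← hrk] at hr
  have hcrit := inner_sub_deriv_eq_zero_of_infDist_eq_s17 h₁ hr
  have hanti : StrictAntiOn (fun t => ⟪y - γ t, γ₁ t⟫) (Icc (s - η) (s + η)) := by
    refine strictAntiOn_of_deriv_neg (convex_Icc _ _)
      (fun q _ => (hasDerivAt_inner_sub h₁ h₂ y q).continuousAt.continuousWithinAt) fun q hq => ?_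
    rw [(hasDerivAt_inner_sub h₁ h₂ y q).deriv]
    rw [interior_Icc] at hq
    have hm := h.pos
    refine (h.slope_le ?_).trans_lt (by simpa using by positivity)
    refine le_trans ?_ (h.norm_sub_le s q (by rw [abs_le]; constructor <;> linarith [hq.1, hq.2]))
    have : 0 ≤ K := (norm_nonneg _).trans (h.norm_le 0)
    gcongr
    have d1 := dist_triangle4 y x (γ s) (γ q)
    rw [← hs] at d1
    rw [← dist_eq_norm, ← dist_eq_norm]
    linarith
  rw [abs_le] at hts
  have hk' : |(r - k) - s| < η := by convert hk using 2; ring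
  rw [abs_lt] at hk'
  have : t = r - k := hanti.injOn ⟨by linarith, by linarith⟩ ⟨by linarith, by linarith⟩
    (by simp only [ht, hcrit])
  rw [this, hr, dist_eq_norm]

end IsTubeScale

end Curve

/-- Near `x`, the distance to `Λ` is the norm of a differentiable field `X` with `(X')ᵀ X = X` whose
divergence at `x` differs from `n - 1` by at most `C * dist(x, Λ)`. -/
def HasOffsetField {n : ℕ} (Λ : Set (EuclideanSpace ℝ (Fin n))) (C : ℝ)
    (x : EuclideanSpace ℝ (Fin n)) : Prop :=
  ∃ (X : EuclideanSpace ℝ (Fin n) → EuclideanSpace ℝ (Fin n))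
    (X' : EuclideanSpace ℝ (Fin n) →L[ℝ] EuclideanSpace ℝ (Fin n)),
    (∀ᶠ y in 𝓝 x, infDist y Λ = ‖X y‖) ∧
    (∀ᶠ y in 𝓝 x, ∃ Y : EuclideanSpace ℝ (Fin n) →L[ℝ] EuclideanSpace ℝ (Fin n),
      HasFDerivAt X Y y ∧ ∀ v, ⟪X y, Y v⟫ = ⟪X y, v⟫) ∧
    HasFDerivAt X X' x ∧
    |∑ i, X' (EuclideanSpace.single i 1) i - (n - 1)| ≤ C * infDist x Λ

/-- Points close to a closed embedded curve have an offset field, namely `y ↦ y - π y` where `π` is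
the nearest-point projection. -/
lemma exists_hasOffsetField {n : ℕ} {γ : ℝ → EuclideanSpace ℝ (Fin n)}
    (hγ : ContDiff ℝ (⊤ : ℕ∞) γ) (hper : Function.Periodic γ 1) (hreg : ∀ t : ℝ, deriv γ t ≠ 0)
    (hinj : ∀ s t : ℝ, γ s = γ t → ∃ k : ℤ, s - t = (k : ℝ)) :
    ∃ ε₁ > 0, ∃ C : ℝ, 0 ≤ C ∧ ∀ x, infDist x (range γ) < ε₁ → HasOffsetField (range γ) C x := by
  have hC1 : ContDiff ℝ (⊤ : ℕ∞) (deriv γ) := (contDiff_infty_iff_deriv.1 hγ).2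
  have hC2 : ContDiff ℝ (⊤ : ℕ∞) (deriv (deriv γ)) := (contDiff_infty_iff_deriv.1 hC1).2
  have h₁ : ∀ t, HasDerivAt γ (deriv γ t) t := fun t =>
    (hγ.differentiable (by simp) t).hasDerivAt
  have h₂ : ∀ t, HasDerivAt (deriv γ) (deriv (deriv γ) t) t := fun t =>
    (hC1.differentiable (by simp) t).hasDerivAt
  have hderiv : ∀ {f : ℝ → EuclideanSpace ℝ (Fin n)}, Function.Periodic f 1 →
      Function.Periodic (deriv f) 1 := fun {f} hf t => by
    rw [← deriv_comp_add_const, show (fun x => f (x + 1)) = f from funext hf]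
  obtain ⟨m, K, η, ε, h⟩ := exists_isTubeScale h₁ hC1.continuous hC2.continuous hper
    (hderiv hper) (hderiv (hderiv hper)) hreg hinj
  have hmpos := h.pos
  have hKnn : 0 ≤ K := (norm_nonneg _).trans (h.norm_le 0)
  have hcpt : IsCompact (range γ) := hper.compact_of_continuous one_ne_zero hγ.continuous
  have hproj : ∀ y, ∃ r, infDist y (range γ) = dist y (γ r) := fun y => by
    obtain ⟨_, ⟨r, rfl⟩, hr⟩ := hcpt.exists_infDist_eq_dist (range_nonempty γ) y
    exact ⟨r, hr⟩
  refine ⟨ε, h.radius_pos, K / (m ^ 2 / 2), by positivity, fun x hx => ?_⟩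
  obtain ⟨s, hs⟩ := hproj x
  have hcrit := inner_sub_deriv_eq_zero_of_infDist_eq_s17 h₁ hs
  have hslope : ⟪x - γ s, deriv (deriv γ) s⟫ - ‖deriv γ s‖ ^ 2 ≤ -(m ^ 2 / 2) := by
    refine h.slope_le (le_trans ?_ (h.norm_sub_le s s (by simpa using h.scale_pos.le)))
    rw [← dist_eq_norm, ← hs]
    have := h.radius_pos
    gcongr
    rw [sub_self, norm_zero]
    linarith
  have hslope' : ⟪x - γ s, deriv (deriv γ) s⟫ - ‖deriv γ s‖ ^ 2 < 0 :=
    hslope.trans_lt (by simpa using by positivity)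
  obtain ⟨τ, hτx, hτ, hτ0⟩ := exists_implicit_parameter h₁ h₂ (hγ.of_le (by simp))
    (hC1.of_le (by simp)) hcrit hslope'.ne
  have hcomp : ∀ {f : ℝ → EuclideanSpace ℝ (Fin n)} {f' y}, HasDerivAt f f' (τ y) →
      DifferentiableAt ℝ τ y →
      HasFDerivAt (fun y => f (τ y)) ((fderiv ℝ τ y).smulRight f') y := fun {f f' y} hf hy =>
    (hf.hasFDerivAt.comp y hy.hasFDerivAt).congr_fderiv (by ext; simp)
  have hXd : ∀ y, DifferentiableAt ℝ τ y → HasFDerivAt (fun y => y - γ (τ y))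
      (ContinuousLinearMap.id ℝ _ - (fderiv ℝ τ y).smulRight (deriv γ (τ y))) y := fun y hy =>
    (hasFDerivAt_id y).sub (hcomp (h₁ (τ y)) hy)
  have hXx := hXd x (hτ.differentiableAt (by simp))
  refine ⟨fun y => y - γ (τ y), _, ?_, ?_, hXx, ?_⟩
  · have hτc : ∀ᶠ y in 𝓝 x, |τ y - s| ≤ η := by
      have := hτ.continuousAt.tendsto.eventually (closedBall_mem_nhds _ h.scale_pos)
      rwa [hτx] at this
    filter_upwards [hτ0, hτc, ball_mem_nhds x h.radius_pos] with y hy1 hy2 hy3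
    obtain ⟨r, hr⟩ := hproj y
    exact h.infDist_eq h₁ h₂ hper hs hx hy3 hy2 hy1 hr
  · filter_upwards [hτ0, hτ.eventually (by simp)] with y hy1 hy2
    refine ⟨_, hXd y (hy2.differentiableAt (by simp)), fun v => ?_⟩
    simp [inner_sub_right, real_inner_smul_right, hy1]
  · set a := ‖deriv γ s‖ ^ 2 with ha
    set b := ⟪x - γ s, deriv (deriv γ) s⟫ with hb
    have hτ' : ∀ v, (a - b) * fderiv ℝ τ x v = ⟪deriv γ s, v⟫ := fun v => by
      have e1 : HasFDerivAt (fun y => ⟪y - γ (τ y), deriv γ (τ y)⟫) _ x :=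
        hXx.inner ℝ (hcomp (h₂ (τ x)) (hτ.differentiableAt (by simp)))
      have e2 := e1.unique ((hasFDerivAt_const (0 : ℝ) x).congr_of_eventuallyEq hτ0)
      have e3 := congrArg (fun L => L v) e2
      simp only [hτx, ContinuousLinearMap.comp_apply, ContinuousLinearMap.prod_apply,
        fderivInnerCLM_apply, ContinuousLinearMap.smulRight_apply, ContinuousLinearMap.id_apply,
        sub_apply, zero_apply, real_inner_smul_right] at e3
      rw [inner_sub_left v, real_inner_smul_left, real_inner_self_eq_norm_sq, ← ha, ← hb,
        real_inner_comm] at e3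
      linarith
    have htr : ∑ i, (ContinuousLinearMap.id ℝ (EuclideanSpace ℝ (Fin n)) -
        (fderiv ℝ τ x).smulRight (deriv γ (τ x)))
        (EuclideanSpace.single i 1) i - ((n : ℝ) - 1) = -b / (a - b) := by
      have hab : a - b ≠ 0 := by linarith
      have : (a - b) * ∑ i, fderiv ℝ τ x (EuclideanSpace.single i 1) * deriv γ s i = a := by
        rw [Finset.mul_sum]
        refine Eq.trans ?_ (EuclideanSpace.norm_sq_eq (deriv γ s)).symm
        refine Finset.sum_congr rfl fun i _ => ?_
        rw [← mul_assoc, hτ', EuclideanSpace.inner_single_right]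
        simp [sq]
      rw [eq_div_iff hab]
      simp [hτx]
      linarith
    rw [htr, abs_div, abs_neg, abs_of_pos (by linarith : 0 < a - b), hs, div_mul_eq_mul_div,
      dist_eq_norm]
    have hbK : |b| ≤ K * ‖x - γ s‖ := by
      refine (abs_real_inner_le_norm _ _).trans ?_
      rw [mul_comm]
      gcongr
      exact h.norm_le s
    gcongr
    linarith

/-- The Laplacian of a radial function of the rescaled distance is, up to `O(ε)`, the rescaled
Laplacian of the radial function on the unit ball of the normal space. -/
lemma exists_hasLapAt_infDist {n m : ℕ} (hm : 0 < m) (hmn : (m : ℝ) = n - 1)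
    {Λ : Set (EuclideanSpace ℝ (Fin n))} {ε₁ C : ℝ} (hC : 0 ≤ C)
    (hΛ : ∀ x, infDist x Λ < ε₁ → HasOffsetField Λ C x)
    {U : EuclideanSpace ℝ (Fin m) → ℝ} {U₀ : ℝ → ℝ} (hUrad : ∀ z, U z = U₀ ‖z‖)
    (hU : ContDiffOn ℝ 2 U (closedBall 0 1)) :
    ∃ D, 0 ≤ D ∧ ∀ ε, 0 < ε → ε ≤ ε₁ → ∀ x, infDist x Λ < ε → ∀ z, ‖z‖ = infDist x Λ / ε →
      ∃ c, HasLapAt (fun y => U₀ (infDist y Λ / ε)) c x ∧ |ε ^ 2 * c - lap U z| ≤ D * ε := by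
  obtain ⟨p, p₁, p₂, D, hp, hpU, hlap⟩ := exists_isRadialProfile hm hUrad hU
  have hD : 0 ≤ D := (abs_nonneg _).trans (hp.bound 0 (by simp))
  refine ⟨D * C, by positivity, fun ε hε hε₁ x hx z hz => ?_⟩
  obtain ⟨X, X', hX1, hX2, hX3, hX4⟩ := hΛ x (hx.trans_le hε₁)
  have hnorm : ∀ y, ‖ε⁻¹ • X y‖ = ‖X y‖ / ε := fun y => by
    rw [norm_smul, norm_inv, Real.norm_of_nonneg hε.le]; ring
  have hzX : ‖ε⁻¹ • X x‖ = ‖z‖ := by rw [hnorm, hz, hX1.self_of_nhds]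
  have hz1 : ‖z‖ < 1 := by rwa [hz, div_lt_one hε]
  have hL := hp.hasLapAt ε⁻¹ (X := fun y => ε⁻¹ • X y) (X' := ε⁻¹ • X') (x := x)
    (f := fun y => U₀ (infDist y Λ / ε)) (by
      filter_upwards [hX1] with y hy
      rw [hnorm, hy, hpU _ (by positivity)]) (by
      filter_upwards [hX2] with y ⟨Y, hY1, hY2⟩
      refine ⟨ε⁻¹ • Y, hY1.fun_const_smul _, fun v => ?_⟩
      simp [real_inner_smul_left, real_inner_smul_right, hY2]) (hX3.fun_const_smul _)
    (by rwa [hzX])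
  refine ⟨_, hL, ?_⟩
  rw [hzX, hlap z (by simpa using hz1), hmn]
  have hsum : ∑ i, (ε⁻¹ • X') (EuclideanSpace.single i 1) i =
      ε⁻¹ * ∑ i, X' (EuclideanSpace.single i 1) i := by
    simp [Finset.mul_sum]
  rw [hsum]
  have hslope := hp.abs_radialSlope_le (r := ‖z‖) ⟨by linarith [norm_nonneg z], hz1⟩
  set G := radialSlope p₁ p₂ ‖z‖
  set tr := ∑ i, X' (EuclideanSpace.single i 1) i
  have e : ε ^ 2 * (ε⁻¹ * (G * (ε⁻¹ * tr) + (p₂ ‖z‖ - G) * ε⁻¹)) -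
      (p₂ ‖z‖ + ((n : ℝ) - 1 - 1) * G) = G * (tr - (n - 1)) := by
    field_simp
    ring
  rw [e, abs_mul, mul_assoc]
  gcongr
  exact hX4.trans (by gcongr)

/-- Comparison with a nonnegative strict supersolution `w` of `ε² Δ + q`. -/
lemma le_mul_of_lap_le {n : ℕ} {T : Set (EuclideanSpace ℝ (Fin n))} (hT : IsOpen T)
    (hTc : IsCompact (closure T)) {w q v : EuclideanSpace ℝ (Fin n) → ℝ} {ε M S : ℝ} (hS : 0 ≤ S)
    (hwc : ContinuousOn w (closure T)) (hw0 : ∀ x ∈ closure T, 0 ≤ w x)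
    (hq : ∀ x ∈ T, q x ≤ M)
    (hw : ∀ x ∈ T, ∃ c, HasLapAt w c x ∧ ε ^ 2 * c + q x * w x ≤ -(3 / 4))
    (hvc : ContinuousOn v (closure T)) (hv0 : ∀ x ∈ frontier T, v x = 0)
    (hv : ∀ x ∈ T, ∃ c, HasLapAt v c x ∧ -S ≤ ε ^ 2 * c + q x * v x) :
    ∀ x ∈ T, v x ≤ 4 / 3 * S * w x := by
  intro x₀ hx₀
  by_contra! hlt
  set K := 4 / 3 * S with hK
  have hK0 : 0 ≤ K := by positivity
  obtain ⟨δ, hδ, hδM⟩ : ∃ δ > 0, M * δ ≤ 1 / 4 := by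
    refine ⟨1 / (4 * (|M| + 1)), by positivity, ?_⟩
    rw [mul_one_div, div_le_iff₀ (by positivity)]
    linarith [le_abs_self M]
  have hΨ : ∀ x ∈ closure T, 0 < w x + δ := fun x hx => by linarith [hw0 x hx]
  obtain ⟨x₁, hx₁, hmax⟩ := hTc.exists_isMaxOn ⟨x₀, subset_closure hx₀⟩
    (f := fun x => (v x - K * w x) / (w x + δ))
    ((hvc.sub (hwc.const_mul K)).div (hwc.add continuousOn_const) fun x hx => (hΨ x hx).ne')
  set μ := (v x₁ - K * w x₁) / (w x₁ + δ) with hμ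
  have hμpos : 0 < μ :=
    (div_pos (sub_pos.2 hlt) (hΨ x₀ (subset_closure hx₀))).trans_le (hmax (subset_closure hx₀))
  have hx₁T : x₁ ∈ T := by
    by_contra hx₁T
    have h1 := hv0 x₁ ⟨hx₁, by rwa [hT.interior_eq]⟩
    have h2 : μ ≤ 0 := div_nonpos_of_nonpos_of_nonneg
      (by rw [h1]; linarith [mul_nonneg hK0 (hw0 x₁ hx₁)]) (hΨ x₁ hx₁).le
    linarith
  obtain ⟨a, ha, ha'⟩ := hw x₁ hx₁T
  obtain ⟨b, hb, hb'⟩ := hv x₁ hx₁T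
  have heq : v x₁ - K * w x₁ = μ * (w x₁ + δ) := by
    rw [hμ, div_mul_cancel₀ _ (hΨ x₁ hx₁).ne']
  have hloc : IsLocalMax (fun y => v y + -(K + μ) * w y) x₁ := by
    filter_upwards [hT.mem_nhds hx₁T] with y hy
    have h1 : (v y - K * w y) / (w y + δ) ≤ μ := hmax (subset_closure hy)
    rw [div_le_iff₀ (hΨ y (subset_closure hy))] at h1
    linarith
  have hle := (hb.add (ha.const_mul (-(K + μ)))).nonpos_of_isLocalMax hloc
  have h1 := mul_nonpos_of_nonneg_of_nonpos (sq_nonneg ε) hle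
  have h2 := mul_le_mul_of_nonneg_left ha' (by linarith : 0 ≤ K + μ)
  have h3 := mul_le_mul_of_nonneg_right (hq x₁ hx₁T) (mul_pos hμpos hδ).le
  have h4 := mul_le_mul_of_nonneg_left hδM hμpos.le
  have h5 : q x₁ * (v x₁ - K * w x₁) = q x₁ * (μ * (w x₁ + δ)) := by rw [heq]
  linarith

/-- The iteration `K ↦ a + (2/3) K` drives any valid bound down to its fixed point `3 a`. -/
lemma abs_le_of_contracting_bound {ι : Type*} {v w : ι → ℝ} {a K₀ : ℝ} (ha : 0 ≤ a) (hK₀ : 0 < K₀)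
    (h0 : ∀ x, |v x| ≤ K₀ * w x)
    (hstep : ∀ K, 0 ≤ K → (∀ x, |v x| ≤ K * w x) → ∀ x, |v x| ≤ (a + 2 / 3 * K) * w x) (x : ι) :
    |v x| ≤ 3 * a * w x := by
  have hw : ∀ y, 0 ≤ w y := fun y =>
    nonneg_of_mul_nonneg_right ((abs_nonneg _).trans (h0 y)) hK₀
  have key : ∀ j : ℕ, ∀ y, |v y| ≤ (3 * a + (2 / 3) ^ j * K₀) * w y := fun j => by
    induction j with
    | zero =>
      intro y
      have := mul_nonneg ha (hw y)
      linarith [h0 y]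
    | succ j ih =>
      intro y
      refine (hstep _ (by positivity) ih y).trans_eq ?_
      ring
  have hlim : Tendsto (fun j : ℕ => (3 * a + (2 / 3 : ℝ) ^ j * K₀) * w x) atTop
      (𝓝 ((3 * a + 0 * K₀) * w x)) :=
    (((tendsto_pow_atTop_nhds_zero_of_lt_one (by norm_num) (by norm_num)).mul_const _).const_add
      _).mul_const _
  simpa using ge_of_tendsto' hlim fun j => key j x

/-- With `u_ε(x) = U(dist(x,Λ)/ε)`, `w_ε(x) = W(dist(x,Λ)/ε)` and
`B = max(1, 2‖λ e^U W‖_{L^∞(B^{n-1})})`, any solution of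
`Δ(u_ε + v) + (λ/ε²) e^{u_ε + v} = 0` in `T_ε(Λ)` with `v = 0` on `∂T_ε(Λ)` and
`|v| ≤ 1/B` satisfies `|v| ≤ C ε w_ε` on `T_ε(Λ)`, for a constant `C` independent of
`ε`, for all sufficiently small `ε`. -/
theorem tube_perturbation_a_priori_bound
    (n : ℕ) (hn : 3 ≤ n)
    -- `Λ = range γ` is a smooth closed curve embedded in `ℝⁿ`
    (γ : ℝ → EuclideanSpace ℝ (Fin n)) (hγ_smooth : ContDiff ℝ (⊤ : ℕ∞) γ)
    (hγ_per : Function.Periodic γ 1)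
    (hγ_reg : ∀ t : ℝ, deriv γ t ≠ 0)
    (hγ_inj : ∀ s t : ℝ, γ s = γ t → ∃ k : ℤ, s - t = (k : ℝ))
    (Λ : Set (EuclideanSpace ℝ (Fin n))) (hΛ : Λ = Set.range γ)
    (lam : ℝ) (hlam : 0 < lam)
    -- `U` is a radial stable solution of the Gelfand problem in `B^{n-1}`, of profile `U₀`
    (U : EuclideanSpace ℝ (Fin (n - 1)) → ℝ) (U₀ : ℝ → ℝ)
    (hUrad : ∀ z : EuclideanSpace ℝ (Fin (n - 1)), U z = U₀ ‖z‖)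
    (hUC2 : ContDiffOn ℝ 2 U (closedBall (0 : EuclideanSpace ℝ (Fin (n - 1))) 1))
    (hUsol : ∀ z ∈ ball (0 : EuclideanSpace ℝ (Fin (n - 1))) 1, lap U z + lam * exp (U z) = 0)
    (hUbdry : ∀ z ∈ sphere (0 : EuclideanSpace ℝ (Fin (n - 1))) 1, U z = 0)
    (hUstab : ∀ φ : EuclideanSpace ℝ (Fin (n - 1)) → ℝ, ContDiff ℝ 1 φ → HasCompactSupport φ →
      tsupport φ ⊆ ball (0 : EuclideanSpace ℝ (Fin (n - 1))) 1 →
      lam * ∫ z in ball (0 : EuclideanSpace ℝ (Fin (n - 1))) 1, exp (U z) * φ z ^ 2 ≤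
        ∫ z in ball (0 : EuclideanSpace ℝ (Fin (n - 1))) 1, ‖gradient φ z‖ ^ 2)
    -- `W` is the radial solution of `−ΔW − λ e^U W = 1` in `B^{n-1}`, of profile `W₀`
    (W : EuclideanSpace ℝ (Fin (n - 1)) → ℝ) (W₀ : ℝ → ℝ)
    (hWrad : ∀ z : EuclideanSpace ℝ (Fin (n - 1)), W z = W₀ ‖z‖)
    (hWC2 : ContDiffOn ℝ 2 W (closedBall (0 : EuclideanSpace ℝ (Fin (n - 1))) 1))
    (hWsol : ∀ z ∈ ball (0 : EuclideanSpace ℝ (Fin (n - 1))) 1,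
      -(lap W z) - lam * exp (U z) * W z = 1)
    (hWbdry : ∀ z ∈ sphere (0 : EuclideanSpace ℝ (Fin (n - 1))) 1, W z = 0)
    -- the constant `B = max(1, 2‖λ e^U W‖_{L^∞(B^{n-1})})`
    (B : ℝ)
    (hB : B = max 1 (2 * sSup ((fun z => |lam * exp (U z) * W z|) ''
      ball (0 : EuclideanSpace ℝ (Fin (n - 1))) 1))) :
    ∃ C > (0 : ℝ), ∃ ε₀ > (0 : ℝ), ∀ ε : ℝ, 0 < ε → ε < ε₀ →
      ∀ v : EuclideanSpace ℝ (Fin n) → ℝ,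
        ContDiffOn ℝ 2 v (closure (tube Λ ε)) →
        (∀ x ∈ tube Λ ε,
          lap (fun y => U₀ (Metric.infDist y Λ / ε) + v y) x +
            lam / ε ^ 2 * exp (U₀ (Metric.infDist x Λ / ε) + v x) = 0) →
        (∀ x ∈ frontier (tube Λ ε), v x = 0) →
        (∀ x ∈ tube Λ ε, |v x| ≤ 1 / B) →
        ∀ x ∈ tube Λ ε, |v x| ≤ C * ε * W₀ (Metric.infDist x Λ / ε) := by
  subst hΛ
  have hm0 : 0 < n - 1 := by omega
  have hmn : ((n - 1 : ℕ) : ℝ) = n - 1 := by rw [Nat.cast_sub (by omega)]; simp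
  obtain ⟨ε₁, hε₁, C₂, hC₂, hfield⟩ := exists_hasOffsetField hγ_smooth hγ_per hγ_reg hγ_inj
  obtain ⟨DU, hDU, hlapU⟩ := exists_hasLapAt_infDist hm0 hmn hC₂ hfield hUrad hUC2
  obtain ⟨DW, hDW, hlapW⟩ := exists_hasLapAt_infDist hm0 hmn hC₂ hfield hWrad hWC2
  have hWnn := nonneg_of_stable hlam hUC2.continuousOn hUstab hWC2 hWsol hWbdry
  have hcpt := isCompact_closedBall (0 : EuclideanSpace ℝ (Fin (n - 1))) 1
  obtain ⟨M, hM⟩ := hcpt.exists_bound_of_continuousOn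
    (f := fun z => lam * exp (U z)) (by have := hUC2.continuousOn; fun_prop)
  obtain ⟨N, hN⟩ := hcpt.exists_bound_of_continuousOn (f := fun z => lam * exp (U z) * W z)
    (by have := hUC2.continuousOn; have := hWC2.continuousOn; fun_prop)
  have hB1 : 1 ≤ B := hB ▸ le_max_left _ _
  have hqW : ∀ z ∈ ball (0 : EuclideanSpace ℝ (Fin (n - 1))) 1, lam * exp (U z) * W z ≤ B / 2 := by
    intro z hz
    have h1 : |lam * exp (U z) * W z| ≤ sSup ((fun z => |lam * exp (U z) * W z|) '' ball 0 1) := by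
      refine le_csSup ⟨N, ?_⟩ (mem_image_of_mem _ hz)
      rintro _ ⟨y, hy, rfl⟩
      exact hN y (ball_subset_closedBall hy)
    have h2 := le_max_right 1 (2 * sSup ((fun z => |lam * exp (U z) * W z|) '' ball 0 1))
    rw [← hB] at h2
    linarith [le_abs_self (lam * exp (U z) * W z)]
  set e : EuclideanSpace ℝ (Fin (n - 1)) := EuclideanSpace.single ⟨0, hm0⟩ 1 with he
  have hen : ∀ r : ℝ, 0 ≤ r → ‖r • e‖ = r := fun r hr => by
    simp [he, norm_smul, abs_of_nonneg hr]
  refine ⟨4 * (DU + 1), by positivity, min ε₁ (1 / (4 * (DW + 1))), by positivity,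
    fun ε hε hεlt v hvC hvlap hvbdry hvB => ?_⟩
  have hεε₁ : ε ≤ ε₁ := (hεlt.trans_le (min_le_left _ _)).le
  have hεDW : DW * ε ≤ 1 / 4 := by
    have := hεlt.trans_le (min_le_right _ _)
    rw [lt_div_iff₀ (by positivity)] at this
    linarith
  set Λ := range γ with hΛ
  set T := tube Λ ε with hT
  have hTo : IsOpen T := isOpen_lt (continuous_infDist_pt Λ) continuous_const
  have hTle : ∀ x ∈ closure T, infDist x Λ ≤ ε :=
    closure_minimal (fun x (hx : infDist x Λ < ε) => hx.le)
      (isClosed_le (continuous_infDist_pt Λ) continuous_const)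
  have hTc : IsCompact (closure T) := by
    have hΛc : IsCompact Λ := hγ_per.compact_of_continuous one_ne_zero hγ_smooth.continuous
    refine hΛc.cthickening (r := ε) |>.of_isClosed_subset isClosed_closure ?_
    refine closure_minimal (fun x hx => thickening_subset_cthickening _ _ ?_) isClosed_cthickening
    exact mem_thickening_iff.2 ((infDist_lt_iff (range_nonempty γ)).1 hx)
  set z : EuclideanSpace ℝ (Fin n) → EuclideanSpace ℝ (Fin (n - 1)) := fun x => (infDist x Λ / ε) • e
    with hz
  have hzn : ∀ x, ‖z x‖ = infDist x Λ / ε := fun x =>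
    hen _ (by have := infDist_nonneg (x := x) (s := Λ); positivity)
  have hzc : Continuous z := ((continuous_infDist_pt Λ).div_const ε).smul continuous_const
  have hzT : ∀ x ∈ T, z x ∈ ball 0 1 := fun x hx => by
    rw [mem_ball_zero_iff, hzn, div_lt_one hε]
    exact hx
  have hzT' : ∀ x ∈ closure T, z x ∈ closedBall 0 1 := fun x hx => by
    rw [mem_closedBall_zero_iff, hzn, div_le_one hε]
    exact hTle x hx
  have hUz : ∀ x, U₀ (infDist x Λ / ε) = U (z x) := fun x => by rw [hUrad, hzn]
  have hWz : ∀ x, W₀ (infDist x Λ / ε) = W (z x) := fun x => by rw [hWrad, hzn]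
  set w : EuclideanSpace ℝ (Fin n) → ℝ := fun x => W₀ (infDist x Λ / ε) with hw
  set q : EuclideanSpace ℝ (Fin n) → ℝ := fun x => lam * exp (U (z x)) with hq
  have hq0 : ∀ x, 0 ≤ q x := fun x => by positivity
  have hqM : ∀ x ∈ T, q x ≤ M := fun x hx =>
    (le_abs_self _).trans (hM _ (hzT' x (subset_closure hx)))
  have hwc : ContinuousOn w (closure T) :=
    (hWC2.continuousOn.comp hzc.continuousOn hzT').congr fun x _ => hWz x
  have hw0 : ∀ x ∈ closure T, 0 ≤ w x := fun x hx => by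
    rw [hw]
    simp only [hWz]
    rcases (mem_closedBall_zero_iff.1 (hzT' x hx)).lt_or_eq with h | h
    · exact hWnn _ (mem_ball_zero_iff.2 h)
    · exact (hWbdry _ (mem_sphere_zero_iff_norm.2 h)).ge
  have hwsup : ∀ x ∈ T, ∃ c, HasLapAt w c x ∧ ε ^ 2 * c + q x * w x ≤ -(3 / 4) := fun x hx => by
    obtain ⟨c, hc, hc'⟩ := hlapW ε hε hεε₁ x hx (z x) (hzn x)
    refine ⟨c, hc, ?_⟩
    have h1 := hWsol (z x) (hzT x hx)
    have h2 : q x * w x = lam * exp (U (z x)) * W (z x) := by rw [hq, hw]; simp only [hWz]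
    rw [h2]
    linarith [(abs_le.1 hc').2]
  have hvcd : ∀ x ∈ T, ContDiffAt ℝ 2 v x := fun x hx =>
    hvC.contDiffAt (mem_of_superset (hTo.mem_nhds hx) subset_closure)
  have hcomp : ∀ S, 0 ≤ S → (∀ x ∈ T, |ε ^ 2 * lap v x + q x * v x| ≤ S) →
      ∀ x ∈ T, |v x| ≤ 4 / 3 * S * w x := by
    intro S hS hvS x hx
    refine abs_le'.2 ⟨?_, ?_⟩
    · exact le_mul_of_lap_le hTo hTc hS hwc hw0 hqM hwsup hvC.continuousOn hvbdry
        (fun y hy => ⟨_, (hvcd y hy).hasLapAt, (abs_le.1 (hvS y hy)).1⟩) x hx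
    · refine le_mul_of_lap_le hTo hTc hS hwc hw0 hqM hwsup (v := fun y => -1 * v y)
        (hvC.continuousOn.const_mul (-1)) (fun y hy => by rw [hvbdry y hy, mul_zero])
        (fun y hy => ⟨_, (hvcd y hy).hasLapAt.const_mul (-1), ?_⟩) x hx |>.trans' (by simp)
      linarith [(abs_le.1 (hvS y hy)).2]
  have hrhs : ∀ x ∈ T, |ε ^ 2 * lap v x + q x * v x| ≤ DU * ε + q x * |v x| / B := by
    intro x hx
    obtain ⟨c, hc, hc'⟩ := hlapU ε hε hεε₁ x hx (z x) (hzn x)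
    have h1 := hvlap x hx
    rw [(hc.add (hvcd x hx).hasLapAt).2, hUz, Real.exp_add] at h1
    have h2 : ε ^ 2 * lap v x + q x * v x =
        -(ε ^ 2 * c - lap U (z x)) - q x * (exp (v x) - 1 - v x) := by
      have h3 : lap U (z x) = -q x := by linarith [hUsol (z x) (hzT x hx)]
      have h4 : ε ^ 2 * (c + lap v x) + q x * exp (v x) = 0 := by
        rw [← mul_zero (ε ^ 2), ← h1]
        simp only [hq]
        field_simp
      rw [h3]
      linarith
    have hv1 := hvB x hx
    have h5 : |exp (v x) - 1 - v x| ≤ |v x| / B := by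
      have : 1 / B ≤ 1 := by rw [div_le_one (by linarith)]; exact hB1
      refine (Real.abs_exp_sub_one_sub_id_le (hv1.trans this)).trans ?_
      rw [← sq_abs, sq, div_eq_mul_one_div]
      gcongr
    rw [h2]
    refine (abs_sub _ _).trans ?_
    rw [abs_neg, abs_mul, abs_of_nonneg (hq0 x), mul_div_assoc]
    have := hq0 x
    gcongr
  have hstep : ∀ K, 0 ≤ K → (∀ x : T, |v x| ≤ K * w x) →
      ∀ x : T, |v x| ≤ (4 / 3 * (DU * ε) + 2 / 3 * K) * w x := by
    intro K hK hvK x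
    refine (hcomp (DU * ε + K / 2) (by positivity) (fun y hy => (hrhs y hy).trans ?_) x x.2).trans_eq
      (by ring)
    have h1 : q y * w y ≤ B / 2 := by
      simp only [hq, hw, hWz]
      exact hqW (z y) (hzT y hy)
    have h2 : q y * |v y| / B ≤ K / 2 := by
      rw [div_le_iff₀ (by linarith)]
      have h3 := mul_le_mul_of_nonneg_left (hvK ⟨y, hy⟩) (hq0 y)
      have h4 := mul_le_mul_of_nonneg_left h1 hK
      linarith
    linarith
  have hinit : ∀ x : T, |v x| ≤ 4 / 3 * (DU * ε + |M| + 1) * w x := by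
    intro x
    refine hcomp _ (by positivity) (fun y hy => (hrhs y hy).trans ?_) x x.2
    have h1 : |v y| / B ≤ 1 := by
      rw [div_le_one (by linarith)]
      refine (hvB y hy).trans (le_trans ?_ hB1)
      rw [div_le_one (by linarith)]
      exact hB1
    have h2 := mul_le_mul (hqM y hy |>.trans (le_abs_self M)) h1 (by positivity) (by positivity)
    rw [mul_div_assoc]
    linarith
  intro x hx
  have hfin := abs_le_of_contracting_bound (v := fun x : T => v x) (w := fun x : T => w x)
    (by positivity) (by positivity) hinit hstep ⟨x, hx⟩
  refine hfin.trans ?_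
  have := mul_nonneg hε.le (hw0 x (subset_closure hx))
  simp only
  linarith
end
end
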